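/- arXiv:1005.0371 — 8 statements merged into one kernel-verified Lean document; each statement's English description precedes it below -/
import Mathlib

section
/- Let ν be a positive measure on (0,∞) with ∫_{(0,∞)} (1+r)⁻¹ ν(dr) < ∞, and let A₁(ω) = ω² ∫_{(0,∞)} (ω² + r²)⁻¹ ν(dr) for ω > 0. Then A₁(ω) = o(ω) as ω → ∞, i.e. A₁(ω)/ω → 0 as ω → ∞. -/
open MeasureTheory Filter Topology

/-- If `ν` is a positive measure on `(0,∞)` with `∫ (1+r)⁻¹ ν(dr) < ∞` and
`A₁(ω) = ω² ∫ (ω² + r²)⁻¹ ν(dr)` for `ω > 0`, then `A₁(ω) = o(ω)` as `ω → ∞`. -/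
theorem attenuation_sublinear (ν : Measure ℝ)
    (hν : IntegrableOn (fun r : ℝ => (1 + r)⁻¹) (Set.Ioi 0) ν)
    (A₁ : ℝ → ℝ)
    (hA : ∀ ω : ℝ, 0 < ω →
      A₁ ω = ω ^ 2 * ∫ r in Set.Ioi (0 : ℝ), (ω ^ 2 + r ^ 2)⁻¹ ∂ν) :
    Tendsto (fun ω : ℝ => A₁ ω / ω) atTop (𝓝 0) := by
  have hlim : Tendsto (fun ω : ℝ => ∫ r in Set.Ioi (0 : ℝ), ω * (ω ^ 2 + r ^ 2)⁻¹ ∂ν) atTop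
      (𝓝 (∫ _ in Set.Ioi (0 : ℝ), (0 : ℝ) ∂ν)) := by
    refine tendsto_integral_filter_of_dominated_convergence (fun r : ℝ => 2 * (1 + r)⁻¹)
      (.of_forall fun ω => Measurable.aestronglyMeasurable (by fun_prop)) ?_ (hν.const_mul 2)
      (.of_forall fun r => ?_)
    · filter_upwards [eventually_ge_atTop 1] with ω hω
      filter_upwards [ae_restrict_mem measurableSet_Ioi] with r (hr : 0 < r)
      rw [Real.norm_of_nonneg (by positivity), ← div_eq_mul_inv, ← div_eq_mul_inv,
        div_le_div_iff₀ (by positivity) (by positivity)]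
      nlinarith [sq_nonneg (ω - r)]
    · refine squeeze_zero' ?_ ?_ tendsto_inv_atTop_zero
      · filter_upwards [eventually_gt_atTop 0] with ω hω
        positivity
      · filter_upwards [eventually_gt_atTop 0] with ω hω
        rw [← div_eq_mul_inv, ← one_div, div_le_div_iff₀ (by positivity) hω]
        nlinarith [sq_nonneg r]
  rw [integral_zero] at hlim
  refine hlim.congr' ?_
  filter_upwards [eventually_gt_atTop 0] with ω hω
  rw [hA ω hω, integral_const_mul]
  field_simp
end

section
/- Suppose f : ℂ ∖ (−∞,0] → ℂ is analytic on the complex plane cut along the non-positive real axis, f(x) is real for all real x > 0, f(x) tends to a limit f(0⁺) ≥ 0 as x → 0⁺, f(conj z) = conj(f(z)) for all z in the cut plane, and Im f(z) ≥ 0 whenever Im z > 0. Then there exist constants a, b ≥ 0 and a positive measure ν on (0,∞) with ∫_{(0,∞)} (1+r)⁻¹ ν(dr) < ∞ such that f(x) = a + b·x + x ∫_{(0,∞)} (x+r)⁻¹ ν(dr) for all real x > 0. -/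
open MeasureTheory Filter Topology

lemma one_sub_abs_sq_le (s θ : ℝ) : (1 - |s|) ^ 2 ≤ 1 - 2 * s * Real.cos θ + s ^ 2 := by
  have h : s * Real.cos θ ≤ |s| := by
    refine (le_abs_self _).trans ?_
    rw [abs_mul]
    exact mul_le_of_le_one_right (abs_nonneg s) (Real.abs_cos_le_one θ)
  nlinarith [sq_abs s]

lemma one_sub_two_mul_cos_add_sq_pos {s : ℝ} (hs : |s| < 1) (θ : ℝ) :
    0 < 1 - 2 * s * Real.cos θ + s ^ 2 :=
  (pow_pos (sub_pos.2 hs) 2).trans_le (one_sub_abs_sq_le s θ)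

lemma div_sub_sub_inv_one_sub_mul_circleMap {s : ℝ} (hs : |s| < 1) (θ : ℝ) :
    circleMap 0 1 θ / (circleMap 0 1 θ - s) - (1 - s * circleMap 0 1 θ)⁻¹ =
      ((s * ((1 - 2 * s * Real.cos θ + s ^ 2)⁻¹ * (2 * Real.sin θ)) : ℝ) : ℂ) * -Complex.I := by
  have hD := one_sub_two_mul_cos_add_sq_pos hs θ
  set D := 1 - 2 * s * Real.cos θ + s ^ 2 with hDdef
  have hζ : circleMap 0 1 θ = Real.cos θ + Real.sin θ * Complex.I := by
    simp [circleMap, Complex.exp_mul_I]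
  have hζ0 : circleMap 0 1 θ ≠ 0 := by simp [circleMap]
  have hcs : (Real.cos θ : ℂ) ^ 2 + (Real.sin θ : ℂ) ^ 2 = 1 := by
    exact_mod_cast Real.cos_sq_add_sin_sq θ
  have hDc : (D : ℂ) ≠ 0 := by exact_mod_cast hD.ne'
  have hDc' : (D : ℂ) = 1 - 2 * s * Real.cos θ + s ^ 2 := by rw [hDdef]; push_cast; ring
  set ζ := circleMap 0 1 θ
  have h1 : ζ ^ 2 + 1 = 2 * Real.cos θ * ζ := by
    rw [hζ]; linear_combination (-1 : ℂ) * hcs + (Real.sin θ : ℂ) ^ 2 * Complex.I_sq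
  have h2 : 1 - ζ ^ 2 = -2 * Complex.I * Real.sin θ * ζ := by
    rw [hζ]; linear_combination (-1 : ℂ) * hcs + (Real.sin θ : ℂ) ^ 2 * Complex.I_sq
  have h3 : (ζ - s) * (1 - s * ζ) = D * ζ := by
    rw [hDc']; linear_combination (-s : ℂ) * h1
  have h4 : (ζ - s) * (1 - s * ζ) ≠ 0 := by rw [h3]; exact mul_ne_zero hDc hζ0
  have h5 := left_ne_zero_of_mul h4
  have h6 := right_ne_zero_of_mul h4
  have : ζ / (ζ - s) - (1 - s * ζ)⁻¹ = s * (1 - ζ ^ 2) / ((ζ - s) * (1 - s * ζ)) := by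
    rw [← one_div, div_sub_div _ _ h5 h6]
    ring
  rw [this, h2, h3]
  push_cast
  field_simp

/-- A holomorphic function on the unit disc is recovered on the real diameter, up to an additive
constant, from the imaginary parts of its boundary values. -/
lemma re_sub_re_zero_eq_integral {G : ℂ → ℂ} (hG : DiffContOnCl ℂ G (Metric.ball 0 1))
    {s : ℝ} (hs : |s| < 1) :
    (G s).re - (G 0).re = s * ((2 * Real.pi)⁻¹ * ∫ θ in 0..2 * Real.pi,
      (1 - 2 * s * Real.cos θ + s ^ 2)⁻¹ *
        (2 * (Real.sin θ * (G (circleMap 0 1 θ)).im))) := by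
  have hs' : (s : ℂ) ∈ Metric.ball (0 : ℂ) |1| := by simpa using hs
  have hG' : DiffContOnCl ℂ G (Metric.ball 0 |1|) := by simpa using hG
  have hz : ∀ z : ℂ, ‖z‖ ≤ 1 → 1 - s * z ≠ 0 := by
    intro z hz h
    have h1 : (s : ℂ) * z = 1 := by linear_combination -h
    have h2 : |s| * ‖z‖ = 1 := by simpa using congrArg norm h1
    nlinarith [norm_nonneg z, abs_nonneg s]
  have hcont : ContinuousOn G (Metric.sphere 0 1) :=
    hG.2.mono (by
      rw [closure_ball _ one_ne_zero]; exact Metric.sphere_subset_closedBall)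
  have hH : DiffContOnCl ℂ (fun z : ℂ => (1 - s * z)⁻¹ • G z) (Metric.ball 0 |1|) := by
    refine DiffContOnCl.smul (DifferentiableOn.diffContOnCl ?_) hG'
    rw [abs_one, closure_ball _ one_ne_zero]
    intro z hz'
    have := hz z (by simpa using hz')
    fun_prop (disch := assumption)
  have hI1 : CircleIntegrable (fun z : ℂ => (z / (z - s)) • G z) 0 1 := by
    refine ContinuousOn.circleIntegrable zero_le_one ?_
    refine ContinuousOn.smul (f := fun z : ℂ => z / (z - s))
      (ContinuousOn.div (by fun_prop) (by fun_prop) ?_) hcont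
    intro z hz' h
    have h1 : z = s := by linear_combination h
    have h2 : ‖z‖ = 1 := by simpa using hz'
    rw [h1] at h2
    simp at h2
    linarith
  have hI2 : CircleIntegrable (fun z : ℂ => (1 - s * z)⁻¹ • G z) 0 1 := by
    refine ContinuousOn.circleIntegrable zero_le_one ?_
    refine ContinuousOn.smul (f := fun z : ℂ => (1 - s * z)⁻¹)
      (ContinuousOn.inv₀ (by fun_prop) ?_) hcont
    intro z hz'
    exact hz z (by simpa using (Metric.sphere_subset_closedBall hz'))
  have e1 := hG'.circleAverage_smul_div hs'
  have e2 := hH.circleAverage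
  have e3 := Real.circleAverage_fun_sub hI1 hI2
  simp only [sub_zero] at e1
  rw [e1, e2] at e3
  have hI3 := hI1.sub hI2
  have e4 := Complex.reCLM.circleAverage_comp_comm hI3
  have e5 : Real.circleAverage ((fun z : ℂ => (z / (z - s)) • G z) -
      fun z : ℂ => (1 - s * z)⁻¹ • G z) 0 1
      = G s - G 0 := by
    rw [← show G s - (1 - (s : ℂ) * 0)⁻¹ • G 0 = G s - G 0 by simp, ← e3]; rfl
  rw [e5] at e4
  simp only [Complex.reCLM_apply, Complex.sub_re] at e4
  rw [← e4, Real.circleAverage_def, smul_eq_mul, mul_left_comm,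
    ← intervalIntegral.integral_const_mul s]
  congr 2
  ext θ
  simp only [Function.comp, Pi.sub_apply, Complex.reCLM_apply]
  rw [← sub_smul, div_sub_sub_inv_one_sub_mul_circleMap hs, smul_eq_mul, mul_assoc,
    Complex.re_ofReal_mul]
  simp
  ring

/-- Integral representation, on the real diameter, of a holomorphic function on the unit disc whose
imaginary part has the same sign as the imaginary part of the variable. -/
lemma exists_measure_of_im_mul_im_nonneg {g : ℂ → ℂ}
    (hg : DifferentiableOn ℂ g (Metric.ball 0 1))
    (hpos : ∀ z ∈ Metric.ball (0 : ℂ) 1, 0 ≤ z.im * (g z).im) :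
    ∃ μ : FiniteMeasure ℝ, ∀ s : ℝ, |s| < 1 →
      (g s).re = (g 0).re + s * ∫ θ, (1 - 2 * s * Real.cos θ + s ^ 2)⁻¹ ∂(μ : Measure ℝ) := by
  obtain ⟨ρ, -, hρ, hρlim⟩ := exists_seq_strictMono_tendsto' (zero_lt_one (α := ℝ))
  set G : ℕ → ℂ → ℂ := fun n z => g (ρ n * z) with hGdef
  have hmem : ∀ n (z : ℂ), ‖z‖ ≤ 1 → (ρ n * z : ℂ) ∈ Metric.ball (0 : ℂ) 1 := by
    intro n z hz
    have := hρ n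
    simp only [mem_ball_zero_iff, norm_mul, Complex.norm_real, Real.norm_eq_abs,
      abs_of_pos this.1]
    nlinarith [this.1, this.2, norm_nonneg z]
  have hGd : ∀ n, DifferentiableOn ℂ (G n) (Metric.closedBall 0 1) := fun n =>
    hg.comp (by fun_prop) fun z hz => hmem n z (by simpa using hz)
  have hG : ∀ n, DiffContOnCl ℂ (G n) (Metric.ball 0 1) := fun n =>
    DifferentiableOn.diffContOnCl (by rw [closure_ball _ one_ne_zero]; exact hGd n)
  have hGlim : ∀ s : ℝ, |s| < 1 → Tendsto (fun n => (G n s).re) atTop (𝓝 (g s).re) := by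
    intro s hs
    have h1 : ContinuousAt g s :=
      (hg.differentiableAt (Metric.isOpen_ball.mem_nhds (by simpa using hs))).continuousAt
    have h2 : Tendsto (fun n => (ρ n * s : ℂ)) atTop (𝓝 (s : ℂ)) := by
      have := ((Complex.continuous_ofReal.tendsto 1).comp hρlim).mul_const (s : ℂ)
      simpa using this
    exact (Complex.continuous_re.tendsto _).comp (h1.tendsto.comp h2)
  set w : ℕ → ℝ → ℝ := fun n θ =>
    (2 * Real.pi)⁻¹ * (2 * (Real.sin θ * (G n (circleMap 0 1 θ)).im)) with hwdef
  have hwc : ∀ n, Continuous (w n) := by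
    intro n
    have h1 : Continuous fun θ => G n (circleMap 0 1 θ) :=
      (hGd n).continuousOn.comp_continuous (continuous_circleMap 0 1) fun θ => by simp
    have h2 := Complex.continuous_im.comp h1
    exact continuous_const.mul (continuous_const.mul (Real.continuous_sin.mul h2))
  have hw0 : ∀ n θ, 0 ≤ w n θ := by
    intro n θ
    have h1 := hpos _ (hmem n (circleMap 0 1 θ) (by simp))
    have h2 : (ρ n * circleMap 0 1 θ : ℂ).im = ρ n * Real.sin θ := by
      simp [circleMap, Complex.exp_mul_I, Complex.sin_ofReal_re]
    rw [h2, mul_assoc] at h1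
    have h3 := nonneg_of_mul_nonneg_right h1 (hρ n).1
    have := Real.pi_pos
    simp only [hwdef]
    positivity
  set I : Measure ℝ := volume.restrict (Set.Ioc 0 (2 * Real.pi)) with hI
  have hwfin : ∀ n, IsFiniteMeasure (I.withDensity fun θ => ENNReal.ofReal (w n θ)) := fun n =>
    isFiniteMeasure_withDensity_ofReal (((hwc n).integrableOn_Ioc).2)
  set m : ℕ → FiniteMeasure ℝ := fun n => ⟨I.withDensity fun θ => ENNReal.ofReal (w n θ), hwfin n⟩
    with hm
  have hInt : ∀ n (h : ℝ → ℝ), ∫ θ, h θ ∂(m n : Measure ℝ) =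
      ∫ θ in 0..2 * Real.pi, w n θ * h θ := by
    intro n h
    rw [intervalIntegral.integral_of_le Real.two_pi_pos.le]
    refine (integral_withDensity_eq_integral_toReal_smul
      ((hwc n).measurable.ennreal_ofReal) (by simp) h).trans ?_
    simp only [ENNReal.toReal_ofReal (hw0 n _), smul_eq_mul]
    rfl
  have hrep : ∀ n (s : ℝ), |s| < 1 → (G n s).re = (g 0).re +
      s * ∫ θ, (1 - 2 * s * Real.cos θ + s ^ 2)⁻¹ ∂(m n : Measure ℝ) := by
    intro n s hs
    have h1 := re_sub_re_zero_eq_integral (hG n) hs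
    have h2 : G n 0 = g 0 := by simp [hGdef]
    rw [h2, ← intervalIntegral.integral_const_mul] at h1
    rw [hInt, ← sub_eq_iff_eq_add', h1]
    congr 2
    ext θ
    simp only [hwdef]
    ring
  have hbd : ∀ s : ℝ, |s| < 1 → ∀ θ, ‖(1 - 2 * s * Real.cos θ + s ^ 2)⁻¹‖ ≤ ((1 - |s|) ^ 2)⁻¹ := by
    intro s hs θ
    rw [Real.norm_of_nonneg (inv_nonneg.2 (one_sub_two_mul_cos_add_sq_pos hs θ).le)]
    exact inv_anti₀ (pow_pos (sub_pos.2 hs) 2) (one_sub_abs_sq_le s θ)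
  have hkc : ∀ s : ℝ, |s| < 1 → Continuous fun θ => (1 - 2 * s * Real.cos θ + s ^ 2)⁻¹ := by
    intro s hs
    exact Continuous.inv₀ (by fun_prop) fun θ => (one_sub_two_mul_cos_add_sq_pos hs θ).ne'
  have hhalf : |(1 / 2 : ℝ)| < 1 := by rw [abs_of_pos] <;> norm_num
  obtain ⟨B, hB⟩ := (hGlim (1 / 2) hhalf).bddAbove_range
  have hmass : ∀ n, ((m n).mass : ℝ) ≤ 9 / 2 * (B - (g 0).re) := by
    intro n
    have h1 := hrep n (1 / 2) hhalf
    have h2 : (G n (1 / 2 : ℝ)).re ≤ B := hB ⟨n, rfl⟩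
    have h3 : ∫ θ, (4 / 9 : ℝ) ∂(m n : Measure ℝ) ≤
        ∫ θ, (1 - 2 * (1 / 2) * Real.cos θ + (1 / 2) ^ 2)⁻¹ ∂(m n : Measure ℝ) := by
      refine integral_mono (integrable_const _) (Integrable.of_bound
        (hkc _ hhalf).aestronglyMeasurable _ (ae_of_all _ (hbd _ hhalf))) fun θ => ?_
      rw [show (4 / 9 : ℝ) = (9 / 4)⁻¹ by norm_num]
      refine inv_anti₀ (one_sub_two_mul_cos_add_sq_pos hhalf θ) ?_
      linarith [Real.neg_one_le_cos θ]
    rw [integral_const, smul_eq_mul] at h3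
    change ((m n).mass : ℝ) * _ ≤ _ at h3
    linarith
  set C : NNReal := (9 / 2 * (B - (g 0).re)).toNNReal
  have hsupp : ∀ n, m n (Set.Icc 0 (2 * Real.pi))ᶜ = 0 := by
    intro n
    rw [FiniteMeasure.null_iff_toMeasure_null]
    refine withDensity_absolutelyContinuous _ _ ?_
    rw [hI, Measure.restrict_apply measurableSet_Icc.compl]
    convert measure_empty (μ := (volume : Measure ℝ))
    ext θ
    simp only [Set.mem_inter_iff, Set.mem_compl_iff, Set.mem_Icc, Set.mem_Ioc,
      Set.mem_empty_iff_false, iff_false]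
    intro h
    exact h.1 ⟨h.2.1.le, h.2.2⟩
  obtain ⟨μ, -, hμ⟩ := (isCompact_setOfPred_finiteMeasure_le_of_isCompact C
    (isCompact_Icc (a := 0) (b := 2 * Real.pi))).ultrafilter_le_nhds ((hyperfilter ℕ).map m) (by
      rw [Ultrafilter.coe_map, le_principal_iff, mem_map]
      exact univ_mem' fun n => ⟨NNReal.le_toNNReal_of_coe_le (hmass n), hsupp n⟩)
  refine ⟨μ, fun s hs => ?_⟩
  have hμ' : Tendsto m (hyperfilter ℕ) (𝓝 μ) := hμ
  have h1 := FiniteMeasure.tendsto_iff_forall_integral_tendsto.1 hμ'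
    (BoundedContinuousFunction.ofNormedAddCommGroup _ (hkc s hs) _ (hbd s hs))
  have h2 := (h1.const_mul s).const_add (g 0).re
  refine tendsto_nhds_unique ((hGlim s hs).mono_left Nat.hyperfilter_le_atTop)
    (h2.congr fun n => ?_)
  rw [hrep n s hs]
  rfl

lemma min_one_le_one_add_sub_one_mul (x : ℝ) {q : ℝ} (hq : q ∈ Set.Icc (0 : ℝ) 1) :
    min 1 x ≤ 1 + (x - 1) * q := by
  obtain ⟨h0, h1⟩ := hq
  rcases le_total 1 x with h | h
  · rw [min_eq_left h]; nlinarith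
  · rw [min_eq_right h]; nlinarith

section Moebius

variable {Ω : Type*} [MeasurableSpace Ω] {μ : Measure Ω} [IsFiniteMeasure μ] {q : Ω → ℝ}
  {F : ℝ → ℝ} {f0 : ℝ}

lemma integrable_inv_one_add_sub_one_mul (hqm : Measurable q) (hq : ∀ ω, q ω ∈ Set.Icc (0 : ℝ) 1)
    {x : ℝ} (hx : 0 < x) : Integrable (fun ω => (1 + (x - 1) * q ω)⁻¹) μ := by
  have hm : 0 < min 1 x := lt_min one_pos hx
  refine Integrable.of_bound (by fun_prop) (min 1 x)⁻¹ (ae_of_all _ fun ω => ?_)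
  have h := min_one_le_one_add_sub_one_mul x (hq ω)
  rw [Real.norm_of_nonneg (inv_nonneg.2 (hm.le.trans h))]
  exact inv_anti₀ hm h

/-- If `x ↦ F 1 + (x - 1) ∫ (1 + (x - 1) q)⁻¹ dμ` has a finite limit at `0⁺`, then `(1 - q)⁻¹` is
`μ`-integrable and `q < 1` almost everywhere. -/
lemma ae_lt_one_and_integrable_inv_one_sub (hqm : Measurable q)
    (hq : ∀ ω, q ω ∈ Set.Icc (0 : ℝ) 1)
    (hF : ∀ x, 0 < x → F x = F 1 + (x - 1) * ∫ ω, (1 + (x - 1) * q ω)⁻¹ ∂μ)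
    (hlim : Tendsto F (𝓝[>] 0) (𝓝 f0)) :
    (∀ᵐ ω ∂μ, q ω < 1) ∧ Integrable (fun ω => (1 - q ω)⁻¹) μ := by
  have hid : Tendsto (fun x : ℝ => x) (𝓝[>] 0) (𝓝 0) :=
    tendsto_nhdsWithin_of_tendsto_nhds tendsto_id
  have hmeas : ∀ x : ℝ, Measurable fun ω => (ENNReal.ofReal (1 + (x - 1) * q ω))⁻¹ :=
    fun x => by fun_prop
  have hfatou := lintegral_liminf_le (μ := μ) (u := 𝓝[>] (0 : ℝ)) hmeas
  have hl : ∀ ω, liminf (fun x : ℝ => (ENNReal.ofReal (1 + (x - 1) * q ω))⁻¹) (𝓝[>] 0) =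
      (ENNReal.ofReal (1 - q ω))⁻¹ := by
    intro ω
    refine Tendsto.liminf_eq (tendsto_inv_iff.2 (ENNReal.tendsto_ofReal ?_))
    have := ((hid.sub_const 1).mul_const (q ω)).const_add 1
    rwa [zero_sub, neg_one_mul, ← sub_eq_add_neg] at this
  have hr : Tendsto (fun x : ℝ => ∫⁻ ω, (ENNReal.ofReal (1 + (x - 1) * q ω))⁻¹ ∂μ) (𝓝[>] 0)
      (𝓝 (ENNReal.ofReal ((F 1 - f0) / (1 - 0)))) := by
    refine (ENNReal.tendsto_ofReal ((hlim.const_sub (F 1)).div (hid.const_sub 1)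
      (by norm_num))).congr' ?_
    filter_upwards [Ioo_mem_nhdsGT (zero_lt_one (α := ℝ))] with x hx
    have hpos : ∀ ω, 0 < 1 + (x - 1) * q ω := fun ω =>
      (lt_min one_pos hx.1).trans_le (min_one_le_one_add_sub_one_mul x (hq ω))
    have h1 : (F 1 - F x) / (1 - x) = ∫ ω, (1 + (x - 1) * q ω)⁻¹ ∂μ := by
      rw [div_eq_iff (sub_pos.2 hx.2).ne', hF x hx.1]; ring
    simp only [Pi.div_apply]
    rw [h1, ofReal_integral_eq_lintegral_ofReal (integrable_inv_one_add_sub_one_mul hqm hq hx.1)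
      (ae_of_all _ fun ω => (inv_pos.2 (hpos ω)).le)]
    exact lintegral_congr fun ω => ENNReal.ofReal_inv_of_pos (hpos ω)
  simp only [hl] at hfatou
  rw [hr.liminf_eq] at hfatou
  have hfin := hfatou.trans_lt ENNReal.ofReal_lt_top
  have hae : ∀ᵐ ω ∂μ, q ω < 1 := by
    filter_upwards [ae_lt_top (by fun_prop) hfin.ne] with ω hω
    simpa using hω
  refine ⟨hae, by fun_prop, ?_⟩
  rw [hasFiniteIntegral_iff_ofReal (ae_of_all _ fun ω => inv_nonneg.2 (sub_nonneg.2 (hq ω).2))]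
  refine lt_of_le_of_lt (lintegral_mono_ae ?_) hfin
  filter_upwards [hae] with ω hω
  rw [ENNReal.ofReal_inv_of_pos (sub_pos.2 hω)]

lemma eq_sub_integral_inv_one_sub (hqm : Measurable q)
    (hq : ∀ ω, q ω ∈ Set.Icc (0 : ℝ) 1)
    (hF : ∀ x, 0 < x → F x = F 1 + (x - 1) * ∫ ω, (1 + (x - 1) * q ω)⁻¹ ∂μ)
    (hlim : Tendsto F (𝓝[>] 0) (𝓝 f0)) :
    f0 = F 1 - ∫ ω, (1 - q ω)⁻¹ ∂μ := by
  obtain ⟨hae, hInt⟩ := ae_lt_one_and_integrable_inv_one_sub hqm hq hF hlim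
  have hid : Tendsto (fun x : ℝ => x) (𝓝[>] 0) (𝓝 0) :=
    tendsto_nhdsWithin_of_tendsto_nhds tendsto_id
  have h1 : Tendsto (fun x : ℝ => ∫ ω, (1 + (x - 1) * q ω)⁻¹ ∂μ) (𝓝[>] 0)
      (𝓝 (∫ ω, (1 - q ω)⁻¹ ∂μ)) := by
    refine tendsto_integral_filter_of_dominated_convergence (fun ω => (1 - q ω)⁻¹)
      (Eventually.of_forall fun x => by fun_prop) ?_ hInt ?_
    · filter_upwards [self_mem_nhdsWithin] with x hx
      filter_upwards [hae] with ω hω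
      have hx' : 0 < x := hx
      have h2 : 1 - q ω ≤ 1 + (x - 1) * q ω := by nlinarith [(hq ω).1]
      rw [Real.norm_of_nonneg (inv_nonneg.2 ((sub_pos.2 hω).le.trans h2))]
      exact inv_anti₀ (sub_pos.2 hω) h2
    · filter_upwards [hae] with ω hω
      have := ((hid.sub_const 1).mul_const (q ω)).const_add 1
      rw [zero_sub, neg_one_mul, ← sub_eq_add_neg] at this
      exact this.inv₀ (sub_pos.2 hω).ne'
  have h2 := ((hid.sub_const 1).mul h1).const_add (F 1)
  rw [zero_sub, neg_one_mul, ← sub_eq_add_neg] at h2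
  refine tendsto_nhds_unique hlim (h2.congr' ?_)
  filter_upwards [self_mem_nhdsWithin] with x hx
  exact (hF x hx).symm

lemma exists_stieltjes_measure (hqm : Measurable q)
    (hq : ∀ ω, q ω ∈ Set.Icc (0 : ℝ) 1)
    (hF : ∀ x, 0 < x → F x = F 1 + (x - 1) * ∫ ω, (1 + (x - 1) * q ω)⁻¹ ∂μ)
    (hlim : Tendsto F (𝓝[>] 0) (𝓝 f0)) :
    ∃ b : ℝ, ∃ ν : Measure ℝ, 0 ≤ b ∧
      IntegrableOn (fun r : ℝ => (1 + r)⁻¹) (Set.Ioi 0) ν ∧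
      ∀ x : ℝ, 0 < x → F x = f0 + b * x + x * ∫ r in Set.Ioi (0 : ℝ), (x + r)⁻¹ ∂ν := by
  obtain ⟨hae, hInt⟩ := ae_lt_one_and_integrable_inv_one_sub hqm hq hF hlim
  have hf0 := eq_sub_integral_inv_one_sub hqm hq hF hlim
  set A : Set Ω := {ω | q ω = 0} with hA
  have hAm : MeasurableSet A := hqm (measurableSet_singleton 0)
  set d : Ω → ℝ := fun ω => (q ω * (1 - q ω))⁻¹ with hd
  have hd0 : ∀ ω, 0 ≤ d ω := fun ω =>
    inv_nonneg.2 (mul_nonneg (hq ω).1 (sub_nonneg.2 (hq ω).2))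
  have hdm : Measurable fun ω => ENNReal.ofReal (d ω) := by fun_prop
  set r : Ω → ℝ := fun ω => (1 - q ω) / q ω with hr
  have hrm : Measurable r := by fun_prop
  set lam : Measure Ω := (μ.restrict Aᶜ).withDensity fun ω => ENNReal.ofReal (d ω) with hlam
  have hae' : ∀ᵐ ω ∂μ.restrict Aᶜ, 0 < q ω ∧ q ω < 1 := by
    filter_upwards [ae_restrict_of_ae hae, ae_restrict_mem hAm.compl] with ω h1 h2
    exact ⟨(hq ω).1.lt_of_ne' h2, h1⟩
  have hres : (Measure.map r lam).restrict (Set.Ioi 0) = Measure.map r lam := by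
    refine Measure.restrict_eq_self_of_ae_mem
      ((ae_map_iff hrm.aemeasurable measurableSet_Ioi).2 ?_)
    refine (withDensity_absolutelyContinuous _ _).ae_le ?_
    filter_upwards [hae'] with ω hω
    exact div_pos (sub_pos.2 hω.2) hω.1
  have hker : ∀ x : ℝ, 0 < x → ∀ᵐ ω ∂μ.restrict Aᶜ,
      d ω * (x + r ω)⁻¹ = ((1 - q ω) * (1 + (x - 1) * q ω))⁻¹ := by
    intro x hx
    filter_upwards [hae'] with ω hω
    have h1 := hω.1.ne'
    have h2 := (sub_pos.2 hω.2).ne'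
    have h3 : x + r ω = (1 + (x - 1) * q ω) / q ω := by
      simp only [hr]; field_simp; ring
    rw [h3, hd, inv_div]
    field_simp
  have hsum : ∀ x : ℝ, 0 < x → ∀ᵐ ω ∂μ,
      (1 - q ω)⁻¹ + (x - 1) * (1 + (x - 1) * q ω)⁻¹ =
        x * ((1 - q ω) * (1 + (x - 1) * q ω))⁻¹ := by
    intro x hx
    filter_upwards [hae] with ω hω
    have h2 := (sub_pos.2 hω).ne'
    have h3 := ((lt_min one_pos hx).trans_le (min_one_le_one_add_sub_one_mul x (hq ω))).ne'
    obtain ⟨D, hD⟩ : ∃ D, D = 1 + (x - 1) * q ω := ⟨_, rfl⟩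
    rw [← hD] at h3 ⊢
    field_simp
    rw [hD]
    ring
  have hIntprod : ∀ x : ℝ, 0 < x →
      Integrable (fun ω => ((1 - q ω) * (1 + (x - 1) * q ω))⁻¹) μ := by
    intro x hx
    have h1 := (hInt.add ((integrable_inv_one_add_sub_one_mul (μ := μ) hqm hq hx).const_mul
      (x - 1))).const_mul x⁻¹
    refine h1.congr ?_
    filter_upwards [hsum x hx] with ω hω
    simp only [Pi.add_apply]
    rw [hω, inv_mul_cancel_left₀ hx.ne']
  refine ⟨μ.real A, Measure.map r lam, measureReal_nonneg, ?_, fun x hx => ?_⟩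
  · rw [IntegrableOn, hres, integrable_map_measure (by fun_prop) hrm.aemeasurable, hlam,
      integrable_withDensity_iff_integrable_smul' hdm (by simp)]
    refine (hIntprod 1 one_pos).restrict.congr ?_
    filter_upwards [hker 1 one_pos] with ω hω
    simp only [ENNReal.toReal_ofReal (hd0 ω), smul_eq_mul, Function.comp_apply]
    exact hω.symm
  · have h1 : ∫ t in Set.Ioi (0 : ℝ), (x + t)⁻¹ ∂(Measure.map r lam) =
        ∫ ω in Aᶜ, ((1 - q ω) * (1 + (x - 1) * q ω))⁻¹ ∂μ := by
      rw [hres, integral_map hrm.aemeasurable (by fun_prop), hlam,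
        integral_withDensity_eq_integral_toReal_smul hdm (by simp)]
      refine integral_congr_ae ?_
      filter_upwards [hker x hx] with ω hω
      simp only [ENNReal.toReal_ofReal (hd0 ω), smul_eq_mul]
      exact hω
    have h2 : ∫ ω in A, ((1 - q ω) * (1 + (x - 1) * q ω))⁻¹ ∂μ = μ.real A := by
      rw [setIntegral_congr_fun hAm (g := fun _ => (1 : ℝ))
        fun ω hω => by simp [show q ω = 0 from hω]]
      simp
    have h3 := integral_add_compl hAm (hIntprod x hx)
    have h4 := integral_congr_ae (hsum x hx)
    rw [integral_add hInt ((integrable_inv_one_add_sub_one_mul hqm hq hx).const_mul _),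
      integral_const_mul, integral_const_mul, ← h3, h2] at h4
    rw [h1, hF x hx, hf0]
    linarith

end Moebius

lemma one_add_div_one_sub_re {z : ℂ} :
    ((1 + z) / (1 - z)).re = (1 - ‖z‖ ^ 2) / Complex.normSq (1 - z) := by
  rw [Complex.div_re, ← add_div, ← Complex.normSq_eq_norm_sq, Complex.normSq_apply z]
  simp
  ring

lemma one_add_div_one_sub_im {z : ℂ} :
    ((1 + z) / (1 - z)).im = 2 * z.im / Complex.normSq (1 - z) := by
  rw [Complex.div_im, ← sub_div]
  simp
  ring

lemma normSq_one_sub_pos {z : ℂ} (hz : ‖z‖ < 1) : 0 < Complex.normSq (1 - z) := by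
  refine Complex.normSq_pos.2 fun h => ?_
  rw [← sub_eq_zero.1 h] at hz
  simp at hz

lemma one_add_div_one_sub_re_pos {z : ℂ} (hz : ‖z‖ < 1) : 0 < ((1 + z) / (1 - z)).re := by
  rw [one_add_div_one_sub_re]
  exact div_pos (by nlinarith [norm_nonneg z]) (normSq_one_sub_pos hz)

lemma sq_mem_slitPlane_of_re_pos {w : ℂ} (hw : 0 < w.re) : w ^ 2 ∈ Complex.slitPlane := by
  rw [Complex.mem_slitPlane_iff, pow_two, Complex.mul_re, Complex.mul_im]
  by_cases h : w.im = 0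
  · left; rw [h]; nlinarith
  · right
    intro h2
    have : w.re * w.im = 0 := by linarith
    exact (mul_ne_zero hw.ne' h) this

lemma im_mul_im_nonneg_of_pick {f : ℂ → ℂ}
    (hconj : ∀ z ∈ Complex.slitPlane, f (starRingEnd ℂ z) = starRingEnd ℂ (f z))
    (him : ∀ z : ℂ, 0 < z.im → 0 ≤ (f z).im) (z : ℂ) :
    0 ≤ z.im * (f z).im := by
  rcases lt_trichotomy z.im 0 with h | h | h
  · have h1 := him (starRingEnd ℂ z) (by simpa using h)
    rw [hconj z (Complex.mem_slitPlane_iff.2 (Or.inr h.ne)), Complex.conj_im] at h1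
    exact mul_nonneg_of_nonpos_of_nonpos h.le (by linarith)
  · simp [h]
  · exact mul_nonneg h.le (him z h)

/-- Nevanlinna/Pick characterization of complete Bernstein functions (Theorem 1 of the
paper): if `f` is analytic on the complex plane cut along `(−∞,0]`, real on the positive
reals, tends to a nonnegative limit at `0⁺`, satisfies `f(conj z) = conj (f z)`, and maps
the open upper half-plane into the closed upper half-plane, then `f` has the complete
Bernstein representation `f(x) = a + b x + x ∫_{(0,∞)} (x+r)⁻¹ ν(dr)` on `(0,∞)`. -/
theorem complete_bernstein_characterization (f : ℂ → ℂ)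
    (han : AnalyticOnNhd ℂ f Complex.slitPlane)
    (hreal : ∀ x : ℝ, 0 < x → (f x).im = 0)
    (f0 : ℝ) (hf0 : 0 ≤ f0)
    (hlim : Tendsto (fun x : ℝ => f x) (𝓝[>] (0 : ℝ)) (𝓝 (f0 : ℂ)))
    (hconj : ∀ z ∈ Complex.slitPlane, f (starRingEnd ℂ z) = starRingEnd ℂ (f z))
    (him : ∀ z : ℂ, 0 < z.im → 0 ≤ (f z).im) :
    ∃ a b : ℝ, ∃ ν : Measure ℝ, 0 ≤ a ∧ 0 ≤ b ∧
      IntegrableOn (fun r : ℝ => (1 + r)⁻¹) (Set.Ioi 0) ν ∧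
      ∀ x : ℝ, 0 < x →
        f x = ((a + b * x + x * ∫ r in Set.Ioi (0 : ℝ), (x + r)⁻¹ ∂ν : ℝ) : ℂ) := by
  set g : ℂ → ℂ := fun z => f (((1 + z) / (1 - z)) ^ 2) with hg
  have hgd : DifferentiableOn ℂ g (Metric.ball 0 1) := by
    refine han.differentiableOn.comp (DifferentiableOn.pow (DifferentiableOn.div (by fun_prop)
      (by fun_prop) fun z hz => ?_) 2) fun z hz => ?_
    · exact Complex.normSq_pos.1 (normSq_one_sub_pos (by simpa using hz))
    · exact sq_mem_slitPlane_of_re_pos (one_add_div_one_sub_re_pos (by simpa using hz))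
  have hgpos : ∀ z ∈ Metric.ball (0 : ℂ) 1, 0 ≤ z.im * (g z).im := by
    intro z hz
    have hz' : ‖z‖ < 1 := by simpa using hz
    have h1 := im_mul_im_nonneg_of_pick hconj him (((1 + z) / (1 - z)) ^ 2)
    have h2 : (((1 + z) / (1 - z)) ^ 2).im =
        4 * ((1 + z) / (1 - z)).re / Complex.normSq (1 - z) * z.im := by
      rw [pow_two, Complex.mul_im, one_add_div_one_sub_im]; ring
    have h3 : 0 < 4 * ((1 + z) / (1 - z)).re / Complex.normSq (1 - z) :=
      div_pos (mul_pos four_pos (one_add_div_one_sub_re_pos hz')) (normSq_one_sub_pos hz')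
    rw [h2, mul_assoc] at h1
    exact nonneg_of_mul_nonneg_right h1 h3
  obtain ⟨μ, hμ⟩ := exists_measure_of_im_mul_im_nonneg hgd hgpos
  set q : ℝ → ℝ := fun θ => (1 - Real.cos θ) / 2 with hq
  have hqm : Measurable q := by fun_prop
  have hqI : ∀ θ, q θ ∈ Set.Icc (0 : ℝ) 1 := fun θ =>
    ⟨by simp only [hq]; linarith [Real.cos_le_one θ],
      by simp only [hq]; linarith [Real.neg_one_le_cos θ]⟩
  have hF : ∀ x : ℝ, 0 < x → (f x).re = (f (1 : ℝ)).re +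
      (x - 1) * ∫ θ, (1 + (x - 1) * q θ)⁻¹ ∂((1 / 4 : NNReal) • (μ : Measure ℝ)) := by
    intro x hx
    obtain ⟨y, hy, rfl⟩ : ∃ y : ℝ, 0 < y ∧ y ^ 2 = x :=
      ⟨√x, Real.sqrt_pos.2 hx, Real.sq_sqrt hx.le⟩
    have hy1 : 0 < y + 1 := by linarith
    have hs : |(y - 1) / (y + 1)| < 1 := by
      rw [abs_lt, lt_div_iff₀ hy1, div_lt_iff₀ hy1]
      constructor <;> linarith
    have h1 := hμ _ hs
    have h2 : g ((y - 1) / (y + 1) : ℝ) = f (y ^ 2 : ℝ) := by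
      simp only [hg]
      congr 1
      norm_cast
      congr 1
      field_simp
      ring
    have h3 : g 0 = f (1 : ℝ) := by simp [hg]
    rw [h2, h3] at h1
    rw [h1, integral_smul_nnreal_measure, NNReal.smul_def, smul_eq_mul, ← mul_assoc,
      ← integral_const_mul, ← integral_const_mul]
    congr 2
    ext θ
    have h4 : 1 - 2 * ((y - 1) / (y + 1)) * Real.cos θ + ((y - 1) / (y + 1)) ^ 2 =
        4 / (y + 1) ^ 2 * (1 + (y ^ 2 - 1) * q θ) := by
      simp only [hq]
      field_simp
      ring
    rw [h4, mul_inv, inv_div]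
    push_cast
    field_simp
    ring
  have hlim' : Tendsto (fun x : ℝ => (f x).re) (𝓝[>] 0) (𝓝 f0) :=
    (Complex.continuous_re.tendsto _).comp hlim
  obtain ⟨b, ν, hb, hν, hrep⟩ := exists_stieltjes_measure (F := fun x : ℝ => (f x).re)
    hqm hqI hF hlim'
  refine ⟨f0, b, ν, hf0, hb, hν, fun x hx => ?_⟩
  rw [← hrep x hx]
  exact Complex.ext (by simp) (by simpa using hreal x hx)
end

section
/- Let f(x) = a + b·x + x ∫_{(0,∞)} (x+r)⁻¹ ν(dr) for x > 0, where a, b ≥ 0 and ν is a positive measure on (0,∞) with ∫_{(0,∞)} (1+r)⁻¹ ν(dr) < ∞, and suppose f is not identically zero. Then the function x ↦ x/f(x) also admits such a representation: there exist a′, b′ ≥ 0 and a positive measure ν′ on (0,∞) with ∫_{(0,∞)} (1+r)⁻¹ ν′(dr) < ∞ such that x/f(x) = a′ + b′·x + x ∫_{(0,∞)} (x+r)⁻¹ ν′(dr) for all x > 0. -/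
open MeasureTheory Filter Topology
open scoped CompactlySupported

theorem min_one_le_affine (x : ℝ) {t : ℝ} (ht : t ∈ Set.Icc (0 : ℝ) 1) :
    min x 1 ≤ x * (1 - t) + t := by
  nlinarith [mul_nonneg (sub_nonneg.2 (min_le_left x 1)) (sub_nonneg.2 ht.2),
    mul_nonneg (sub_nonneg.2 (min_le_right x 1)) ht.1]

/-- The spectral measure of a self-adjoint operator at a vector. -/
theorem exists_spectral_measure {H : Type*} [NormedAddCommGroup H] [InnerProductSpace ℂ H]
    [CompleteSpace H] (S : H →L[ℂ] H) (hS : IsSelfAdjoint S) (v : H) :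
    ∃ τ : Measure ℝ, IsFiniteMeasure τ ∧ τ (spectrum ℝ S)ᶜ = 0 ∧
      ∀ φ : ℝ → ℝ, ContinuousOn φ (spectrum ℝ S) →
        ∫ t, φ t ∂τ = (inner ℂ v (cfc φ S v)).re := by
  let Λ : C(spectrum ℝ S, ℝ) →ₗ[ℝ] ℝ :=
    { toFun := fun φ => (inner ℂ v (cfcHom hS φ v)).re
      map_add' := fun φ ψ => by simp
      map_smul' := fun c φ => by simp [inner_smul_right_eq_smul] }
  let Λc : C_c(spectrum ℝ S, ℝ) →ₚ[ℝ] ℝ := PositiveLinearMap.mk₀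
    { toFun := fun φ => Λ φ.toContinuousMap
      map_add' := fun φ ψ => Λ.map_add _ _
      map_smul' := fun c φ => Λ.map_smul _ _ } (by
    intro φ hφ
    have h1 : 0 ≤ cfcHom hS φ.toContinuousMap := (cfcHom_nonneg_iff hS).2 fun t => hφ t
    rw [ContinuousLinearMap.nonneg_iff_isPositive] at h1
    exact h1.re_inner_nonneg_right v)
  have hfin : IsFiniteMeasure (RealRMK.rieszMeasure Λc) := by
    infer_instance
  refine ⟨(RealRMK.rieszMeasure Λc).map Subtype.val, inferInstance, ?_, fun φ hφ => ?_⟩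
  · have hm : MeasurableSet (spectrum ℝ S)ᶜ := (spectrum.isClosed S).measurableSet.compl
    rw [Measure.map_apply measurable_subtype_coe hm]
    simp
  · rw [(MeasurableEmbedding.subtype_coe (spectrum.isClosed S).measurableSet).integral_map]
    have := RealRMK.integral_rieszMeasure Λc
      (CompactlySupportedContinuousMap.continuousMapEquiv ⟨_, hφ.domRestrict⟩)
    rw [cfc_apply φ S hS hφ]
    exact this

theorem cfc_inv_affine_apply {H : Type*} [NormedAddCommGroup H] [InnerProductSpace ℂ H]
    [CompleteSpace H] (S : H →L[ℂ] H) (hS : IsSelfAdjoint S) (x : ℝ)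
    (hx : ∀ t ∈ spectrum ℝ S, x * (1 - t) + t ≠ 0) (z : H) :
    cfc (fun t : ℝ => (x * (1 - t) + t)⁻¹) S ((x : ℂ) • (z - S z) + S z) = z := by
  have hcont : ContinuousOn (fun t : ℝ => (x * (1 - t) + t)⁻¹) (spectrum ℝ S) :=
    ContinuousOn.inv₀ (by fun_prop) hx
  have hA : cfc (fun t : ℝ => x * (1 - t) + t) S = x • (1 - S) + S := by
    rw [cfc_add (a := S) (fun t : ℝ => x * (1 - t)) (fun t => t) (by fun_prop) (by fun_prop),
      cfc_const_mul x (fun t : ℝ => 1 - t) S (by fun_prop),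
      cfc_sub (fun _ : ℝ => 1) (fun t => t) S (by fun_prop) (by fun_prop),
      cfc_const_one ℝ S, cfc_id' ℝ S]
  have hmul : cfc (fun t : ℝ => (x * (1 - t) + t)⁻¹) S * (x • (1 - S) + S) = 1 := by
    rw [← hA, ← cfc_mul _ _ S hcont (by fun_prop), ← cfc_const_one ℝ S]
    exact cfc_congr fun t ht => inv_mul_cancel₀ (hx t ht)
  exact DFunLike.congr_fun hmul z

/-- For `0 ≤ T ≤ 1` and a unit vector `e`, the inverse of `⟪e, (x (1 - T) + T)⁻¹ e⟫` is the Schur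
complement of `x (1 - T) + T` with respect to `e`, expressed through a spectral measure of the
compression of `T` to the orthogonal complement of `e`. -/
theorem exists_schur_complement_measure {H : Type*} [NormedAddCommGroup H]
    [InnerProductSpace ℂ H] [CompleteSpace H] (T : H →L[ℂ] H) (hT0 : T.IsPositive)
    (hT1 : (1 - T).IsPositive) (e : H) (he : ‖e‖ = 1) :
    ∃ (m : ℝ) (τ : Measure ℝ), IsFiniteMeasure τ ∧ τ (Set.Icc 0 1)ᶜ = 0 ∧
      ∀ x : ℝ, 0 < x → ∀ y : H, (x : ℂ) • (y - T y) + T y = e → ∀ F : ℝ, inner ℂ e y = F →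
        F * (x * (1 - m) + m - (1 - x) ^ 2 * ∫ t, (x * (1 - t) + t)⁻¹ ∂τ) = 1 := by
  set P : H →L[ℂ] H := (ℂ ∙ e).starProjection with hP
  set Q : H →L[ℂ] H := (ℂ ∙ e)ᗮ.starProjection with hQ
  have hPe : ∀ z, P z = inner ℂ e z • e := fun z => Submodule.starProjection_unit_singleton ℂ he z
  have hQz : ∀ z, Q z = z - inner ℂ e z • e := fun z => by
    rw [hQ, Submodule.starProjection_orthogonal_val, ← hP, hPe]
  have hee : inner ℂ e e = (1 : ℂ) := by simp [inner_self_eq_norm_sq_to_K, he]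
  set S : H →L[ℂ] H := Q ∘L T ∘L Q with hS
  have hS0 : S.IsPositive := hT0.conj_starProjection _
  have hS1 : (1 - S).IsPositive := by
    have h : 1 - S = P + Q ∘L (1 - T) ∘L Q := by
      ext z
      have hQQ : Q (Q z) = Q z := by
        simp [hQz, hee, -inner_self_eq_norm_sq_to_K]
      have : P z = z - Q z := by rw [hPe, hQz]; abel
      simp [hS, hQQ, this]
    rw [h]
    exact (ContinuousLinearMap.IsPositive.of_isStarProjection
      isStarProjection_starProjection).add (hT1.conj_starProjection _)
  have hSa : IsSelfAdjoint S := hS0.isSelfAdjoint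
  have hspec : spectrum ℝ S ⊆ Set.Icc 0 1 := fun t ht => by
    rw [← ContinuousLinearMap.nonneg_iff_isPositive] at hS0
    refine ⟨spectrum_nonneg_of_nonneg hS0 ht, ?_⟩
    have h1 : S ≤ algebraMap ℝ _ 1 := by
      rw [map_one, ContinuousLinearMap.le_def]; exact hS1
    exact (le_algebraMap_iff_spectrum_le hSa).1 h1 t ht
  set v : H := Q (T e) with hv
  obtain ⟨τ, hτ, hτs, hint⟩ := exists_spectral_measure S hSa v
  refine ⟨(inner ℂ e (T e)).re, τ, hτ, measure_mono_null (Set.compl_subset_compl.2 hspec) hτs,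
    fun x hx y hy F hF => ?_⟩
  set m := (inner ℂ e (T e)).re with hm
  have hTe : inner ℂ e (T e) = (m : ℂ) := by
    have := hT0.inner_nonneg_right e
    rw [Complex.nonneg_iff] at this
    apply Complex.ext <;> simp [hm, ← this.2]
  have hpos : ∀ t ∈ spectrum ℝ S, x * (1 - t) + t ≠ 0 := fun t ht =>
    ((lt_min hx one_pos).trans_le (min_one_le_affine x (hspec ht))).ne'
  rw [hint (fun t => (x * (1 - t) + t)⁻¹) (ContinuousOn.inv₀ (by fun_prop) hpos)]
  set z := y - (F : ℂ) • e with hz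
  have hez : inner ℂ e z = 0 := by
    rw [hz, inner_sub_right, inner_smul_right, hF, hee, mul_one, sub_self]
  have hSz : S z = T z - inner ℂ e (T z) • e := by
    have : Q z = z := by rw [hQz, hez, zero_smul, sub_zero]
    simp only [hS, ContinuousLinearMap.comp_apply, this, hQz]
  have hve : v = T e - (m : ℂ) • e := by rw [hv, hQz, hTe]
  have hTz : (x : ℂ) • (z - T z) + T z = e - (F : ℂ) • ((x : ℂ) • (e - T e) + T e) := by
    rw [hz, map_sub, map_smul]
    linear_combination (norm := module) hy
  have key : (1 - x) * inner ℂ e (T z) = 1 - (F : ℂ) * (x * (1 - m) + m) := by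
    have := congrArg (inner ℂ e) hTz
    simp only [inner_add_right, inner_sub_right, inner_smul_right, hez, hee, hTe] at this
    linear_combination this
  have hAz : (x : ℂ) • (z - S z) + S z = -(F * (1 - x) : ℂ) • v := by
    have key' := congrArg (fun c : ℂ => c • e) key
    rw [hSz, hve]
    linear_combination (norm := module) hTz - key'
  have hzR := cfc_inv_affine_apply S hSa x hpos z
  rw [hAz, map_smul] at hzR
  have hvz : inner ℂ e (T z) = inner ℂ v z := by
    rw [hve, inner_sub_left, inner_smul_left, hez, mul_zero, sub_zero,
      hT0.inner_left_eq_inner_right]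
  rw [hvz, ← hzR, inner_smul_right] at key
  have key2 := congrArg Complex.re key
  simp only [← Complex.ofReal_neg, ← Complex.ofReal_one, ← Complex.ofReal_sub,
    ← Complex.ofReal_mul, Complex.re_ofReal_mul, ← Complex.ofReal_add, Complex.ofReal_re] at key2
  linear_combination key2

/-- Multiplication by a nonnegative function is a positive operator on `L²`. -/
theorem isPositive_of_coeFn_ae_eq_mul {α : Type*} [MeasurableSpace α] {μ : Measure α}
    (A : Lp ℂ 2 μ →L[ℂ] Lp ℂ 2 μ) (a : α → ℝ) (ha : ∀ᵐ t ∂μ, 0 ≤ a t)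
    (hA : ∀ g : Lp ℂ 2 μ, A g =ᵐ[μ] fun t => (a t : ℂ) * g t) : A.IsPositive := by
  rw [ContinuousLinearMap.isPositive_iff_complex]
  intro g
  have h : inner ℂ (A g) g = ((∫ t, a t * ‖g t‖ ^ 2 ∂μ : ℝ) : ℂ) := by
    rw [L2.inner_def, ← integral_complex_ofReal]
    refine integral_congr_ae ?_
    filter_upwards [hA g] with t ht
    rw [ht, RCLike.inner_apply, map_mul, Complex.conj_ofReal, mul_left_comm, Complex.mul_conj']
    push_cast
    ring
  rw [h]
  refine ⟨by simp, ?_⟩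
  simp only [RCLike.re_to_complex, Complex.ofReal_re]
  refine integral_nonneg_of_ae ?_
  filter_upwards [ha] with t ht
  positivity

/-- The inverse of `∫ (x (1 - t) + t)⁻¹ dσ(t)`, where `σ` is a probability measure on `[0, 1]`. -/
theorem exists_measure_inv_integral (σ : Measure ℝ) [IsProbabilityMeasure σ]
    (hσ : σ (Set.Icc 0 1)ᶜ = 0) :
    ∃ (m : ℝ) (τ : Measure ℝ), IsFiniteMeasure τ ∧ τ (Set.Icc 0 1)ᶜ = 0 ∧
      ∀ x : ℝ, 0 < x → (∫ t, (x * (1 - t) + t)⁻¹ ∂σ) *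
        (x * (1 - m) + m - (1 - x) ^ 2 * ∫ t, (x * (1 - t) + t)⁻¹ ∂τ) = 1 := by
  have hσ' : ∀ᵐ t ∂σ, t ∈ Set.Icc (0 : ℝ) 1 := hσ
  have hid : MemLp (fun t : ℝ => (t : ℂ)) ⊤ σ := by
    refine memLp_top_of_bound (by fun_prop) 1 ?_
    filter_upwards [hσ'] with t ht
    simpa [abs_of_nonneg ht.1] using ht.2
  let T : Lp ℂ 2 σ →L[ℂ] Lp ℂ 2 σ :=
    (ContinuousLinearMap.mul ℂ ℂ).holderL σ ⊤ 2 2 (hid.toLp _)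
  have hT : ∀ g : Lp ℂ 2 σ, T g =ᵐ[σ] fun t => (t : ℂ) * g t := fun g => by
    filter_upwards [(ContinuousLinearMap.mul ℂ ℂ).coeFn_holder (r := 2) (hid.toLp _) g,
      hid.coeFn_toLp] with t h1 h2
    refine h1.trans ?_
    rw [h2]; rfl
  have hT0 : T.IsPositive :=
    isPositive_of_coeFn_ae_eq_mul T (fun t => t) (by filter_upwards [hσ'] with t ht using ht.1) hT
  have hT1 : (1 - T).IsPositive := by
    refine isPositive_of_coeFn_ae_eq_mul (1 - T) (fun t => 1 - t)
      (by filter_upwards [hσ'] with t ht using sub_nonneg.2 ht.2) fun g => ?_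
    filter_upwards [hT g, Lp.coeFn_sub g (T g)] with t h1 h2
    refine h2.trans ?_
    rw [Pi.sub_apply, h1]
    push_cast
    ring
  have he : ‖Lp.const 2 σ (1 : ℂ)‖ = 1 := by simp [Lp.norm_const]
  obtain ⟨m, τ, hτ, hτs, h⟩ := exists_schur_complement_measure T hT0 hT1 _ he
  refine ⟨m, τ, hτ, hτs, fun x hx => ?_⟩
  have hx1 : 0 < min x 1 := lt_min hx one_pos
  have hy : MemLp (fun t : ℝ => (((x * (1 - t) + t)⁻¹ : ℝ) : ℂ)) 2 σ := by
    refine MemLp.of_bound (Measurable.aestronglyMeasurable (by fun_prop)) (min x 1)⁻¹ ?_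
    filter_upwards [hσ'] with t ht
    rw [Complex.norm_real, Real.norm_eq_abs, abs_of_nonneg]
    · exact inv_anti₀ hx1 (min_one_le_affine x ht)
    · exact inv_nonneg.2 (hx1.le.trans (min_one_le_affine x ht))
  refine h x hx (hy.toLp _) ?_ _ ?_
  · refine Lp.ext ?_
    set y := hy.toLp _
    filter_upwards [hσ', hT y, hy.coeFn_toLp, Lp.coeFn_add ((x : ℂ) • (y - T y)) (T y),
      Lp.coeFn_smul (x : ℂ) (y - T y), Lp.coeFn_sub y (T y), Lp.coeFn_const 2 σ (1 : ℂ)]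
      with t ht h1 h2 h3 h4 h5 h6
    have hne : x * (1 - t) + t ≠ 0 := (hx1.trans_le (min_one_le_affine x ht)).ne'
    rw [h3, Pi.add_apply, h4, Pi.smul_apply, h5, Pi.sub_apply, h1, h2, h6, Function.const_apply,
      smul_eq_mul, ← Complex.ofReal_one, ← Complex.ofReal_mul, ← Complex.ofReal_sub,
      ← Complex.ofReal_mul, ← Complex.ofReal_add]
    congr 1
    field_simp
  · rw [L2.inner_def, ← integral_complex_ofReal]
    refine integral_congr_ae ?_
    filter_upwards [hy.coeFn_toLp, Lp.coeFn_const 2 σ (1 : ℂ)] with t h2 h6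
    rw [h2, h6]
    simp

theorem integrable_inv_affine {μ : Measure ℝ} [IsFiniteMeasure μ] {s : ℝ → ℝ}
    (hs : Measurable s) (hs01 : ∀ᵐ t ∂μ, s t ∈ Set.Icc (0 : ℝ) 1) {x : ℝ} (hx : 0 < x) :
    Integrable (fun t => (x * (1 - s t) + s t)⁻¹) μ := by
  have hx1 : 0 < min x 1 := lt_min hx one_pos
  refine Integrable.of_bound (Measurable.aestronglyMeasurable (by fun_prop)) (min x 1)⁻¹ ?_
  filter_upwards [hs01] with t ht
  have hd : min x 1 ≤ x * (1 - s t) + s t := min_one_le_affine x ht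
  rw [Real.norm_eq_abs, abs_of_nonneg (inv_nonneg.2 (hx1.le.trans hd))]
  exact inv_anti₀ hx1 hd

theorem integrable_inv_of_forall_integral_le {τ : Measure ℝ} [IsFiniteMeasure τ] {s : ℝ → ℝ}
    (hs : Measurable s) (hs01 : ∀ᵐ t ∂τ, s t ∈ Set.Icc (0 : ℝ) 1) {m : ℝ}
    (h : ∀ w : ℝ, 0 < w → (1 - w) ^ 2 * ∫ t, (w * (1 - s t) + s t)⁻¹ ∂τ ≤ m + w * (1 - m)) :
    (∀ᵐ t ∂τ, 0 < s t) ∧ Integrable (fun t => (s t)⁻¹) τ ∧ ∫ t, (s t)⁻¹ ∂τ ≤ m := by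
  set w : ℕ → ℝ := fun n => 1 / ((n : ℝ) + 2) with hw
  have hw0 : ∀ n, 0 < w n := fun n => by positivity
  have hw1 : ∀ n, w n < 1 := fun n => by
    rw [hw, div_lt_one (by positivity)]
    have : (0 : ℝ) ≤ n := n.cast_nonneg
    linarith
  have hwt : Tendsto w atTop (𝓝 0) := by
    have := (tendsto_const_div_atTop_nhds_zero_nat (1 : ℝ)).comp (tendsto_add_atTop_nat 2)
    refine this.congr fun n => ?_
    simp [hw]
  have hnonneg : ∀ n, 0 ≤ ∫ t, (w n * (1 - s t) + s t)⁻¹ ∂τ := fun n => by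
    refine integral_nonneg_of_ae ?_
    filter_upwards [hs01] with t ht
    exact inv_nonneg.2 (add_nonneg (mul_nonneg (hw0 n).le (sub_nonneg.2 ht.2)) ht.1)
  have hm : 0 ≤ m := by
    have hlim : Tendsto (fun n => m + w n * (1 - m)) atTop (𝓝 (m + 0 * (1 - m))) :=
      (hwt.mul_const _).const_add _
    rw [zero_mul, add_zero] at hlim
    exact ge_of_tendsto' hlim fun n =>
      (mul_nonneg (sq_nonneg _) (hnonneg n)).trans (h _ (hw0 n))
  have hle : ∀ n, ∫⁻ t, (ENNReal.ofReal (w n * (1 - s t) + s t))⁻¹ ∂τ ≤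
      ENNReal.ofReal ((m + w n * (1 - m)) / (1 - w n) ^ 2) := fun n => by
    have hpos : 0 < 1 - w n := sub_pos.2 (hw1 n)
    calc ∫⁻ t, (ENNReal.ofReal (w n * (1 - s t) + s t))⁻¹ ∂τ
        = ∫⁻ t, ENNReal.ofReal (w n * (1 - s t) + s t)⁻¹ ∂τ := by
          refine lintegral_congr_ae ?_
          filter_upwards [hs01] with t ht
          rw [ENNReal.ofReal_inv_of_pos]
          nlinarith [ht.1, ht.2, hw0 n, hw1 n, mul_nonneg hpos.le ht.1]
      _ = ENNReal.ofReal (∫ t, (w n * (1 - s t) + s t)⁻¹ ∂τ) := by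
          refine (ofReal_integral_eq_lintegral_ofReal
            (integrable_inv_affine hs hs01 (hw0 n)) ?_).symm
          filter_upwards [hs01] with t ht
          exact inv_nonneg.2 (add_nonneg (mul_nonneg (hw0 n).le (sub_nonneg.2 ht.2)) ht.1)
      _ ≤ _ := by
          refine ENNReal.ofReal_le_ofReal ?_
          rw [le_div_iff₀ (by positivity), mul_comm]
          exact h _ (hw0 n)
  have hfatou : ∫⁻ t, (ENNReal.ofReal (s t))⁻¹ ∂τ ≤ ENNReal.ofReal m := by
    have hlim : Tendsto (fun n => ENNReal.ofReal ((m + w n * (1 - m)) / (1 - w n) ^ 2)) atTop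
        (𝓝 (ENNReal.ofReal m)) := by
      refine (ENNReal.continuous_ofReal.tendsto _).comp ?_
      have : Tendsto (fun n => (m + w n * (1 - m)) / (1 - w n) ^ 2) atTop
          (𝓝 ((m + 0 * (1 - m)) / (1 - 0) ^ 2)) :=
        ((hwt.mul_const _).const_add _).div ((hwt.const_sub _).pow 2) (by norm_num)
      simpa using this
    have hpt : ∀ t, liminf (fun n => (ENNReal.ofReal (w n * (1 - s t) + s t))⁻¹) atTop =
        (ENNReal.ofReal (s t))⁻¹ := fun t => by
      refine Tendsto.liminf_eq (tendsto_inv_iff.2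
        ((ENNReal.continuous_ofReal.tendsto _).comp ?_))
      simpa using (hwt.mul_const (1 - s t)).add_const (s t)
    calc ∫⁻ t, (ENNReal.ofReal (s t))⁻¹ ∂τ
        = ∫⁻ t, liminf (fun n => (ENNReal.ofReal (w n * (1 - s t) + s t))⁻¹) atTop ∂τ := by
          simp_rw [hpt]
      _ ≤ liminf (fun n => ∫⁻ t, (ENNReal.ofReal (w n * (1 - s t) + s t))⁻¹ ∂τ) atTop :=
          lintegral_liminf_le fun n => by fun_prop
      _ ≤ liminf (fun n => ENNReal.ofReal ((m + w n * (1 - m)) / (1 - w n) ^ 2)) atTop :=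
          liminf_le_liminf (Eventually.of_forall hle)
      _ = ENNReal.ofReal m := hlim.liminf_eq
  have hpos : ∀ᵐ t ∂τ, 0 < s t := by
    filter_upwards [ae_lt_top (by fun_prop) (hfatou.trans_lt ENNReal.ofReal_lt_top).ne] with t ht
    simpa using ht
  have hofReal : ∫⁻ t, ENNReal.ofReal (s t)⁻¹ ∂τ ≤ ENNReal.ofReal m := by
    refine le_of_eq_of_le (lintegral_congr_ae ?_) hfatou
    filter_upwards [hpos] with t ht using ENNReal.ofReal_inv_of_pos ht
  have hnn : 0 ≤ᵐ[τ] fun t => (s t)⁻¹ := by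
    filter_upwards [hpos] with t ht using (inv_pos.2 ht).le
  refine ⟨hpos, ⟨hs.inv.aestronglyMeasurable, ?_⟩, ?_⟩
  · rw [hasFiniteIntegral_iff_ofReal hnn]
    exact hofReal.trans_lt ENNReal.ofReal_lt_top
  · rw [integral_eq_lintegral_of_nonneg_ae hnn hs.inv.aestronglyMeasurable]
    exact ENNReal.toReal_le_of_le_ofReal hm hofReal

/-- The substitution `t = r / (1 + r)` turns a complete Bernstein function into an integral over
`[0, 1]`, the constant and linear terms becoming atoms at the endpoints. -/
theorem exists_measure_Icc_of_stieltjes {a b : ℝ} (ha : 0 ≤ a) (hb : 0 ≤ b) {ν : Measure ℝ}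
    (hν : IntegrableOn (fun r : ℝ => (1 + r)⁻¹) (Set.Ioi 0) ν) :
    ∃ σ : Measure ℝ, IsFiniteMeasure σ ∧ (∀ᵐ t ∂σ, t ∈ Set.Icc (0 : ℝ) 1) ∧
      ∀ x : ℝ, 0 < x → a + b * x + x * ∫ r in Set.Ioi (0 : ℝ), (x + r)⁻¹ ∂ν =
        x * ∫ t, (x * (1 - t) + t)⁻¹ ∂σ := by
  set κ := (ν.restrict (Set.Ioi 0)).withDensity fun r => ENNReal.ofReal (1 + r)⁻¹ with hκ
  have hκfin : IsFiniteMeasure κ := isFiniteMeasure_withDensity_ofReal hν.2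
  have hκpos : ∀ᵐ r ∂κ, 0 < r :=
    (withDensity_absolutelyContinuous _ _).ae_le (ae_restrict_mem measurableSet_Ioi)
  have hφ : Measurable fun r : ℝ => r / (1 + r) := by fun_prop
  set ρ := κ.map fun r => r / (1 + r) with hρ
  have hρ01 : ∀ᵐ t ∂ρ, t ∈ Set.Icc (0 : ℝ) 1 := by
    refine (ae_map_iff (p := (· ∈ Set.Icc (0 : ℝ) 1)) hφ.aemeasurable measurableSet_Icc).2 ?_
    filter_upwards [hκpos] with r hr
    exact ⟨by positivity, (div_le_one (by positivity)).2 (by linarith)⟩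
  have ha01 : ∀ᵐ t ∂(ENNReal.ofReal a • Measure.dirac (0 : ℝ)), t ∈ Set.Icc (0 : ℝ) 1 :=
    Measure.ae_smul_measure
      ((ae_dirac_iff (p := (· ∈ Set.Icc (0 : ℝ) 1)) measurableSet_Icc).2 (by simp)) _
  have hb01 : ∀ᵐ t ∂(ENNReal.ofReal b • Measure.dirac (1 : ℝ)), t ∈ Set.Icc (0 : ℝ) 1 :=
    Measure.ae_smul_measure
      ((ae_dirac_iff (p := (· ∈ Set.Icc (0 : ℝ) 1)) measurableSet_Icc).2 (by simp)) _
  have hafin : IsFiniteMeasure (ENNReal.ofReal a • Measure.dirac (0 : ℝ)) :=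
    Measure.smul_finite _ ENNReal.ofReal_ne_top
  have hbfin : IsFiniteMeasure (ENNReal.ofReal b • Measure.dirac (1 : ℝ)) :=
    Measure.smul_finite _ ENNReal.ofReal_ne_top
  refine ⟨ENNReal.ofReal a • Measure.dirac 0 + ENNReal.ofReal b • Measure.dirac 1 + ρ,
    inferInstance, ?_, fun x hx => ?_⟩
  · simp only [ae_add_measure_iff]
    exact ⟨⟨ha01, hb01⟩, hρ01⟩
  · have hia := integrable_inv_affine measurable_id ha01 hx
    have hib := integrable_inv_affine measurable_id hb01 hx
    have hiρ := integrable_inv_affine measurable_id hρ01 hx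
    simp only [id] at hia hib hiρ
    have hρint : ∫ t, (x * (1 - t) + t)⁻¹ ∂ρ = ∫ r in Set.Ioi (0 : ℝ), (x + r)⁻¹ ∂ν := by
      rw [hρ, integral_map hφ.aemeasurable (Measurable.aestronglyMeasurable (by fun_prop)), hκ,
        integral_withDensity_eq_integral_toReal_smul (by fun_prop)
          (ae_of_all _ fun _ => ENNReal.ofReal_lt_top)]
      refine setIntegral_congr_fun measurableSet_Ioi fun r (hr : 0 < r) => ?_
      have h1 : 0 < 1 + r := by positivity
      have h2 : 0 < x + r := by positivity
      have h3 : x * (1 - r / (1 + r)) + r / (1 + r) = (x + r) / (1 + r) := by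
        field_simp
        ring
      simp only [smul_eq_mul]
      rw [h3, ENNReal.toReal_ofReal (by positivity)]
      field_simp
    rw [integral_add_measure (hia.add_measure hib) hiρ, integral_add_measure hia hib,
      integral_smul_measure, integral_smul_measure, integral_dirac, integral_dirac, hρint,
      ENNReal.toReal_ofReal ha, ENNReal.toReal_ofReal hb]
    simp only [smul_eq_mul]
    field_simp
    ring

theorem exists_stieltjes_of_measure_Icc {τ : Measure ℝ} [IsFiniteMeasure τ] {m : ℝ}
    (h01 : ∀ᵐ t ∂τ, t ∈ Set.Ioo (0 : ℝ) 1) (h0 : Integrable (fun t => t⁻¹) τ)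
    (h1 : Integrable (fun t => (1 - t)⁻¹) τ) :
    ∃ ν : Measure ℝ, IntegrableOn (fun r : ℝ => (1 + r)⁻¹) (Set.Ioi 0) ν ∧
      ∀ x : ℝ, 0 < x → x * (1 - m) + m - (1 - x) ^ 2 * ∫ t, (x * (1 - t) + t)⁻¹ ∂τ =
        (m - ∫ t, t⁻¹ ∂τ) + (1 - m - ∫ t, (1 - t)⁻¹ ∂τ) * x +
          x * ∫ r in Set.Ioi (0 : ℝ), (x + r)⁻¹ ∂ν := by
  set κ := τ.withDensity fun t => ENNReal.ofReal (t * (1 - t) ^ 2)⁻¹ with hκ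
  have hφ : Measurable fun t : ℝ => t / (1 - t) := by fun_prop
  have hκ01 : ∀ᵐ t ∂κ, t ∈ Set.Ioo (0 : ℝ) 1 := (withDensity_absolutelyContinuous _ _).ae_le h01
  have hres : (κ.map fun t => t / (1 - t)).restrict (Set.Ioi 0) = κ.map fun t => t / (1 - t) := by
    refine Measure.restrict_eq_self_of_ae_mem ?_
    refine (ae_map_iff (p := (· ∈ Set.Ioi (0 : ℝ))) hφ.aemeasurable measurableSet_Ioi).2 ?_
    filter_upwards [hκ01] with t ht using div_pos ht.1 (sub_pos.2 ht.2)
  refine ⟨κ.map fun t => t / (1 - t), ?_, fun x hx => ?_⟩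
  · rw [IntegrableOn, hres, integrable_map_measure
      (Measurable.aestronglyMeasurable (by fun_prop)) hφ.aemeasurable, hκ,
      integrable_withDensity_iff_integrable_smul' (by fun_prop)
        (ae_of_all _ fun _ => ENNReal.ofReal_lt_top)]
    refine (h0.add h1).congr ?_
    filter_upwards [h01] with t ⟨ht0, ht1⟩
    have ht1' : 0 < 1 - t := sub_pos.2 ht1
    rw [ENNReal.toReal_ofReal (by positivity)]
    have h3 : 1 + t / (1 - t) = (1 - t)⁻¹ := by field_simp; ring
    simp only [Pi.add_apply, Function.comp_apply, smul_eq_mul, h3]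
    field_simp
    ring
  · have hi := integrable_inv_affine measurable_id
      (h01.mono fun t ht => Set.Ioo_subset_Icc_self ht) hx
    simp only [id] at hi
    have key : x * ∫ r in Set.Ioi (0 : ℝ), (x + r)⁻¹ ∂(κ.map fun t => t / (1 - t)) =
        ∫ t, (t⁻¹ + x * (1 - t)⁻¹ - (1 - x) ^ 2 * (x * (1 - t) + t)⁻¹) ∂τ := by
      rw [hres, integral_map hφ.aemeasurable (Measurable.aestronglyMeasurable (by fun_prop)), hκ,
        integral_withDensity_eq_integral_toReal_smul (by fun_prop)
          (ae_of_all _ fun _ => ENNReal.ofReal_lt_top), ← integral_const_mul]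
      refine integral_congr_ae ?_
      filter_upwards [h01] with t ⟨ht0, ht1⟩
      have ht1' : 0 < 1 - t := sub_pos.2 ht1
      have hd : 0 < x * (1 - t) + t := by positivity
      have h3 : x + t / (1 - t) = (x * (1 - t) + t) / (1 - t) := by field_simp
      rw [ENNReal.toReal_ofReal (by positivity), h3]
      simp only [smul_eq_mul]
      field_simp
      ring
    have hadd : Integrable (fun t => t⁻¹ + x * (1 - t)⁻¹) τ := h0.add (h1.const_mul x)
    rw [key, integral_sub hadd (hi.const_mul _),
      integral_add h0 (h1.const_mul x), integral_const_mul, integral_const_mul]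
    ring

/-- If `f(x) = a + b x + x ∫_{(0,∞)} (x+r)⁻¹ ν(dr)` is a (nonzero) complete Bernstein
function, then `x ↦ x / f(x)` is also a complete Bernstein function. -/
theorem x_div_complete_bernstein (a b : ℝ) (ha : 0 ≤ a) (hb : 0 ≤ b)
    (ν : Measure ℝ)
    (hν : IntegrableOn (fun r : ℝ => (1 + r)⁻¹) (Set.Ioi 0) ν)
    (f : ℝ → ℝ)
    (hf : ∀ x : ℝ, 0 < x →
      f x = a + b * x + x * ∫ r in Set.Ioi (0 : ℝ), (x + r)⁻¹ ∂ν)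
    (hne : ∃ x : ℝ, 0 < x ∧ f x ≠ 0) :
    ∃ a' b' : ℝ, ∃ ν' : Measure ℝ, 0 ≤ a' ∧ 0 ≤ b' ∧
      IntegrableOn (fun r : ℝ => (1 + r)⁻¹) (Set.Ioi 0) ν' ∧
      ∀ x : ℝ, 0 < x →
        x / f x = a' + b' * x + x * ∫ r in Set.Ioi (0 : ℝ), (x + r)⁻¹ ∂ν' := by
  obtain ⟨σ, hσfin, hσ01, hσ⟩ := exists_measure_Icc_of_stieltjes ha hb hν
  have hσ0 : NeZero σ := ⟨by
    rintro rfl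
    obtain ⟨x, hx, hfx⟩ := hne
    exact hfx (by rw [hf x hx, hσ x hx]; simp)⟩
  set c : ℝ := ((σ Set.univ)⁻¹).toReal with hc
  have hctop : (σ Set.univ)⁻¹ ≠ ⊤ := by simp [hσ0.out]
  have hcpos : 0 < c := ENNReal.toReal_pos (by simp) hctop
  set σ' := (σ Set.univ)⁻¹ • σ with hσ'
  have hσ'01 : ∀ᵐ t ∂σ', t ∈ Set.Icc (0 : ℝ) 1 := Measure.ae_smul_measure hσ01 _
  obtain ⟨m, τ, hτfin, hτ01, hG⟩ := exists_measure_inv_integral σ' hσ'01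
  replace hτ01 : ∀ᵐ t ∂τ, t ∈ Set.Icc (0 : ℝ) 1 := hτ01
  set G : ℝ → ℝ := fun x =>
    x * (1 - m) + m - (1 - x) ^ 2 * ∫ t, (x * (1 - t) + t)⁻¹ ∂τ with hGdef
  have hGpos : ∀ x, 0 < x → 0 < G x := fun x hx => by
    have hnn : 0 ≤ ∫ t, (x * (1 - t) + t)⁻¹ ∂σ' := by
      refine integral_nonneg_of_ae ?_
      filter_upwards [hσ'01] with t ht
      exact inv_nonneg.2 (add_nonneg (mul_nonneg hx.le (sub_nonneg.2 ht.2)) ht.1)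
    exact pos_of_mul_pos_right (by rw [hG x hx]; exact one_pos) hnn
  obtain ⟨hpos0, hint0, hle0⟩ := integrable_inv_of_forall_integral_le measurable_id hτ01 (m := m)
    fun w hw => by
      have := hGpos w hw
      simp only [hGdef] at this
      simp only [id]
      linarith
  obtain ⟨hpos1, hint1, hle1⟩ := integrable_inv_of_forall_integral_le (s := fun t => 1 - t)
    (by fun_prop) (by filter_upwards [hτ01] with t ht using ⟨sub_nonneg.2 ht.2, by linarith [ht.1]⟩)
    (m := 1 - m) fun w hw => by
      have := hGpos w⁻¹ (inv_pos.2 hw)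
      have hint : ∫ t, (w⁻¹ * (1 - t) + t)⁻¹ ∂τ =
          w * ∫ t, (w * (1 - (1 - t)) + (1 - t))⁻¹ ∂τ := by
        rw [← integral_const_mul]
        congr 1 with t
        have : w⁻¹ * (1 - t) + t = w⁻¹ * (w * (1 - (1 - t)) + (1 - t)) := by field_simp; ring
        rw [this, mul_inv, inv_inv]
      have hw2 : G w⁻¹ * w = 1 - m + w * (1 - (1 - m)) -
          (1 - w) ^ 2 * ∫ t, (w * (1 - (1 - t)) + (1 - t))⁻¹ ∂τ := by
        simp only [hGdef, hint]
        field_simp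
        ring
      have := mul_pos this hw
      linarith
  obtain ⟨ν', hν', hrep⟩ := exists_stieltjes_of_measure_Icc (m := m)
    (by filter_upwards [hpos0, hpos1] with t h0 h1 using ⟨h0, sub_pos.1 h1⟩) hint0 hint1
  refine ⟨c * (m - ∫ t, t⁻¹ ∂τ), c * (1 - m - ∫ t, (1 - t)⁻¹ ∂τ), (σ Set.univ)⁻¹ • ν',
    mul_nonneg hcpos.le (sub_nonneg.2 hle0), mul_nonneg hcpos.le (sub_nonneg.2 hle1), ?_,
    fun x hx => ?_⟩
  · rw [IntegrableOn, Measure.restrict_smul]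
    exact Integrable.smul_measure hν' hctop
  · have h1 := hG x hx
    rw [hσ', integral_smul_measure, ← hc, hrep x hx, smul_eq_mul] at h1
    have hI : ∫ t, (x * (1 - t) + t)⁻¹ ∂σ ≠ 0 := fun h => by simp [h] at h1
    rw [hf x hx, hσ x hx, Measure.restrict_smul, integral_smul_measure, ← hc, smul_eq_mul,
      div_eq_iff (mul_ne_zero hx.ne' hI)]
    linear_combination (-x) * h1
end

section
/- Let ρ > 0 and let μ be a positive measure on [0,∞) with ∫_{[0,∞)} (1+r)⁻¹ μ(dr) < ∞ and μ({0}) > 0. Define Q(p) = μ({0}) + p ∫_{(0,∞)} (p+r)⁻¹ μ(dr) and B(p) = p·ρ^{1/2}/Q(p)^{1/2} for p > 0. Then there exist a constant c ≥ 0 and a positive measure ν on (0,∞) with ∫_{(0,∞)} (1+r)⁻¹ ν(dr) < ∞ such that B(p) = c·p + p ∫_{(0,∞)} (p+r)⁻¹ ν(dr) for all p > 0; moreover c = lim_{p→∞} B(p)/p. -/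
open MeasureTheory Filter Topology

/-- Orthonormal eigenbasis of the symmetric operator `diag s + w wᵀ`. -/
lemma exists_eigen_decomposition_diagonal_add_rankOne {ι : Type*} [Fintype ι] (s w : ι → ℝ) :
    ∃ (n : ℕ) (t : Fin n → ℝ) (b : OrthonormalBasis (Fin n) ℝ (EuclideanSpace ℝ ι)),
      ∀ k i, s i * b k i + (∑ j, w j * b k j) * w i = t k * b k i := by
  let T : EuclideanSpace ℝ ι →ₗ[ℝ] EuclideanSpace ℝ ι :=
    { toFun := fun x => WithLp.toLp 2 fun i => s i * x i + (∑ j, w j * x j) * w i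
      map_add' := fun x y => by
        ext i
        simp only [PiLp.add_apply, mul_add, Finset.sum_add_distrib]
        ring
      map_smul' := fun a x => by
        ext i
        simp only [PiLp.smul_apply, smul_eq_mul, RingHom.id_apply, mul_left_comm _ a,
          ← Finset.mul_sum]
        ring }
  have hT : T.IsSymmetric := fun x y => by
    simp only [T, LinearMap.coe_mk, AddHom.coe_mk, PiLp.inner_apply, RCLike.inner_apply,
      conj_trivial, mul_add, add_mul, Finset.sum_add_distrib]
    congr 1
    · exact Finset.sum_congr rfl fun i _ => by ring
    · have h1 : ∀ i, y i * ((∑ j, w j * x j) * w i) = (∑ j, w j * x j) * (w i * y i) :=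
        fun i => by ring
      have h2 : ∀ i, (∑ j, w j * y j) * w i * x i = (∑ j, w j * y j) * (w i * x i) :=
        fun i => by ring
      simp only [h1, h2, ← Finset.mul_sum]
      ring
  refine ⟨_, hT.eigenvalues rfl, hT.eigenvectorBasis rfl, fun k i => ?_⟩
  have := congrArg (fun x : EuclideanSpace ℝ ι => x i) (hT.apply_eigenvectorBasis rfl k)
  exact this

/-- The reciprocal of `p` times a finite convex combination of the functions
`p ↦ (1 - s + p s)⁻¹`, `0 ≤ s ≤ 1`, is again such a combination. -/
lemma exists_inv_mul_sum_eq {ι : Type*} [Fintype ι] (τ s : ι → ℝ) (hτ : ∀ i, 0 ≤ τ i)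
    (hsum : ∑ i, τ i = 1) (hs : ∀ i, s i ∈ Set.Icc (0 : ℝ) 1) :
    ∃ (n : ℕ) (c t : Fin n → ℝ), (∀ k, 0 ≤ c k) ∧ (∀ k, t k ∈ Set.Icc (0 : ℝ) 1) ∧
      ∑ k, c k ≤ 1 ∧ ∀ p : ℝ, 0 < p →
        (p * ∑ i, τ i * (1 - s i + p * s i)⁻¹)⁻¹ =
          (1 - ∑ k, c k) + ∑ k, c k * (1 - t k + p * t k)⁻¹ := by
  have pos : ∀ p : ℝ, 0 < p → ∀ x ∈ Set.Icc (0 : ℝ) 1, 0 < 1 - x + p * x := by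
    rintro p hp x ⟨h0, h1⟩
    rcases h0.eq_or_lt with rfl | h0
    · norm_num
    · nlinarith [mul_pos hp h0]
  set w : ι → ℝ := fun i => √(τ i) * √(1 - s i) with hw
  have hw2 : ∀ i, w i ^ 2 = τ i * (1 - s i) := fun i => by
    rw [hw, mul_pow, Real.sq_sqrt (hτ i), Real.sq_sqrt (by linarith [(hs i).2])]
  obtain ⟨n, t, b, hb⟩ := exists_eigen_decomposition_diagonal_add_rankOne s w
  set d : Fin n → ℝ := fun k => ∑ j, w j * b k j with hd
  have hnorm : ∀ k, ∑ i, b k i ^ 2 = 1 := fun k => by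
    have := b.norm_eq_one k
    rw [EuclideanSpace.norm_eq, Real.sqrt_eq_one] at this
    simpa using this
  have ht : ∀ k, t k = ∑ i, s i * b k i ^ 2 + d k ^ 2 := fun k => by
    have : ∑ i, (s i * b k i + d k * w i) * b k i = ∑ i, (t k * b k i) * b k i :=
      Finset.sum_congr rfl fun i _ => by rw [hb]
    have e1 : ∑ i, (s i * b k i + d k * w i) * b k i = ∑ i, s i * b k i ^ 2 + d k ^ 2 := by
      simp only [add_mul, Finset.sum_add_distrib, mul_assoc, ← Finset.mul_sum, sq]
      rfl
    have e2 : ∑ i, (t k * b k i) * b k i = t k := by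
      simp only [mul_assoc, ← sq, ← Finset.mul_sum, hnorm, mul_one]
    linarith
  have hsb : ∀ k, 0 ≤ ∑ i, s i * b k i ^ 2 := fun k =>
    Finset.sum_nonneg fun i _ => mul_nonneg (hs i).1 (sq_nonneg _)
  have hdle : ∀ k, d k ^ 2 ≤ ∑ i, (1 - s i) * b k i ^ 2 := fun k => by
    have := Finset.sum_mul_sq_le_sq_mul_sq Finset.univ (fun i => √(τ i))
      (fun i => √(1 - s i) * b k i)
    simp only [Real.sq_sqrt (hτ _), hsum, one_mul, mul_pow,
      Real.sq_sqrt (sub_nonneg.2 (hs _).2)] at this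
    simpa only [hd, hw, mul_assoc] using this
  have ht01 : ∀ k, t k ∈ Set.Icc (0 : ℝ) 1 := fun k => by
    refine ⟨by rw [ht]; have := hsb k; positivity, ?_⟩
    have := hdle k
    simp only [sub_mul, one_mul, Finset.sum_sub_distrib, hnorm] at this
    linarith [ht k]
  have hd0 : ∀ k, t k = 0 → d k = 0 := fun k hk => by
    have := ht k
    have h2 := hsb k
    exact pow_eq_zero_iff two_ne_zero |>.1 (by nlinarith [sq_nonneg (d k)])
  set c : Fin n → ℝ := fun k => d k ^ 2 / t k with hc
  have hct : ∀ k, c k * t k = d k ^ 2 := fun k => by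
    rcases eq_or_ne (t k) 0 with h | h
    · simp [h, hd0 k h]
    · simp [hc, h]
  have hwd : ∀ a : Fin n → ℝ, ∑ j, w j * (∑ k, a k * b k j) = ∑ k, a k * d k := fun a => by
    simp only [hd, Finset.mul_sum]
    rw [Finset.sum_comm]
    exact Finset.sum_congr rfl fun i _ => Finset.sum_congr rfl fun j _ => by ring
  have hwexp : ∀ i, ∑ k, d k * b k i = w i := fun i => by
    have := congrArg (fun x : EuclideanSpace ℝ ι => x i) (b.sum_repr' (WithLp.toLp 2 w))
    simpa [PiLp.inner_apply, hd] using this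
  refine ⟨n, c, t, fun k => div_nonneg (sq_nonneg _) (ht01 k).1, ht01, ?_, fun p hp => ?_⟩
  · -- `y = ∑ (d k / t k) b k` satisfies `⟪w, y⟫ = ∑ c` and `⟪w, y⟫ ^ 2 ≤ ⟪T y, y⟫ = ∑ c`.
    set y : ι → ℝ := fun i => ∑ k, d k / t k * b k i with hy
    have e1 : ∑ j, w j * y j = ∑ k, c k := by
      rw [hy, hwd]
      exact Finset.sum_congr rfl fun k _ => by simp only [hc]; ring
    have e2 : ∀ i, s i * y i + (∑ k, c k) * w i = w i := fun i => by
      rw [← e1, hy, hwd]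
      refine Eq.trans ?_ (hwexp i)
      rw [Finset.mul_sum, Finset.sum_mul, ← Finset.sum_add_distrib]
      refine Finset.sum_congr rfl fun k _ => ?_
      have := hb k i
      rcases eq_or_ne (t k) 0 with h | h
      · simp [hd0 k h]
      · field_simp
        linear_combination d k * this
    have e3 : ∑ i, s i * y i ^ 2 + (∑ k, c k) ^ 2 = ∑ k, c k := by
      have : ∑ i, (s i * y i + (∑ k, c k) * w i) * y i = ∑ i, w i * y i :=
        Finset.sum_congr rfl fun i _ => by rw [e2]
      simpa only [e1, add_mul, Finset.sum_add_distrib, mul_assoc, ← Finset.mul_sum, ← sq] using this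
    have : 0 ≤ ∑ i, s i * y i ^ 2 :=
      Finset.sum_nonneg fun i _ => mul_nonneg (hs i).1 (sq_nonneg _)
    nlinarith
  · -- `z` solves `(1 + (p - 1) T) z = w`.
    set z : ι → ℝ := fun i => ∑ k, d k / (1 - t k + p * t k) * b k i with hz
    set m : ℝ := ∑ k, d k ^ 2 * (1 - t k + p * t k)⁻¹ with hm
    have e1 : ∑ j, w j * z j = m := by
      rw [hz, hwd]
      exact Finset.sum_congr rfl fun k _ => by ring
    have e2 : ∀ i, z i + (p - 1) * (s i * z i + m * w i) = w i := fun i => by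
      rw [← e1, hz, hwd]
      refine Eq.trans ?_ (hwexp i)
      rw [Finset.mul_sum, Finset.sum_mul, ← Finset.sum_add_distrib, Finset.mul_sum,
        ← Finset.sum_add_distrib]
      refine Finset.sum_congr rfl fun k _ => ?_
      have := div_mul_cancel₀ (d k) (pos p hp _ (ht01 k)).ne'
      linear_combination (p - 1) * (d k / (1 - t k + p * t k)) * hb k i + b k i * this
    have e3 : m = (1 - (p - 1) * m) * ∑ i, w i ^ 2 * (1 - s i + p * s i)⁻¹ := by
      rw [Finset.mul_sum]
      nth_rw 1 [← e1]
      refine Finset.sum_congr rfl fun i _ => ?_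
      have := (pos p hp _ (hs i)).ne'
      field_simp
      linear_combination w i * e2 i
    have e4 : p * ∑ i, τ i * (1 - s i + p * s i)⁻¹ =
        1 + (p - 1) * ∑ i, w i ^ 2 * (1 - s i + p * s i)⁻¹ := by
      refine Eq.trans ?_ (congrArg (· + _) hsum)
      rw [Finset.mul_sum, Finset.mul_sum, ← Finset.sum_add_distrib]
      refine Finset.sum_congr rfl fun i _ => ?_
      have := (pos p hp _ (hs i)).ne'
      rw [hw2]
      field_simp
      ring
    have e5 : 1 - (p - 1) * m = (1 - ∑ k, c k) + ∑ k, c k * (1 - t k + p * t k)⁻¹ := by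
      rw [sub_add, ← Finset.sum_sub_distrib, hm, Finset.mul_sum]
      congr 1
      refine Finset.sum_congr rfl fun k _ => ?_
      have := (pos p hp _ (ht01 k)).ne'
      rw [← hct]
      field_simp
      ring
    rw [← e5, e4]
    refine inv_eq_of_mul_eq_one_right ?_
    linear_combination -(p - 1) * e3

/-- The kernel `(p + r)⁻¹ (1 + r)` in the compactified variable `s = (1 + r)⁻¹`. -/
noncomputable def stieltjesKernel (s : unitInterval) (p : Set.Ioi (0 : ℝ)) : ℝ :=
  (1 - (s : ℝ) + p * s)⁻¹

/-- The normalised Stieltjes functions: the closed convex hull of the kernel functions, for the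
topology of pointwise convergence on `(0, ∞)`. -/
noncomputable def stieltjesHull : Set (Set.Ioi (0 : ℝ) → ℝ) :=
  closure (convexHull ℝ (Set.range stieltjesKernel))

lemma one_sub_add_mul_pos (s : unitInterval) (p : Set.Ioi (0 : ℝ)) :
    0 < 1 - (s : ℝ) + p * s := by
  have hp : 0 < (p : ℝ) := p.2
  rcases s.2.1.eq_or_lt with h | h
  · rw [← h]; norm_num
  · nlinarith [mul_pos hp h, s.2.2]

lemma stieltjesKernel_pos (s : unitInterval) (p : Set.Ioi (0 : ℝ)) : 0 < stieltjesKernel s p :=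
  inv_pos.2 (one_sub_add_mul_pos s p)

lemma continuous_stieltjesKernel (p : Set.Ioi (0 : ℝ)) :
    Continuous fun s => stieltjesKernel s p :=
  Continuous.inv₀ (by fun_prop) fun s => (one_sub_add_mul_pos s p).ne'

lemma le_stieltjesKernel (s : unitInterval) (p : Set.Ioi (0 : ℝ)) :
    (1 + (p : ℝ))⁻¹ ≤ stieltjesKernel s p := by
  have hp : 0 < (p : ℝ) := p.2
  exact inv_anti₀ (one_sub_add_mul_pos s p) (by nlinarith [s.2.1, s.2.2])

lemma stieltjesKernel_le (s : unitInterval) (p : Set.Ioi (0 : ℝ)) :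
    stieltjesKernel s p ≤ 1 + (p : ℝ)⁻¹ := by
  have hp : 0 < (p : ℝ) := p.2
  have h := one_sub_add_mul_pos s p
  refine inv_le_of_inv_le₀ (by positivity) ?_
  rw [inv_le_iff_one_le_mul₀ (by positivity)]
  have : (1 - (s : ℝ) + p * s) * (1 + (p : ℝ)⁻¹) =
    1 + (1 - s) * (p : ℝ)⁻¹ + p * s := by field_simp; ring
  rw [this]
  have : 0 ≤ (1 - (s : ℝ)) * (p : ℝ)⁻¹ := mul_nonneg (by linarith [s.2.2]) (by positivity)
  have := mul_nonneg hp.le s.2.1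
  linarith

lemma integrable_stieltjesKernel (p : Set.Ioi (0 : ℝ)) (σ : Measure unitInterval)
    [IsFiniteMeasure σ] : Integrable (fun s => stieltjesKernel s p) σ :=
  Integrable.of_bound (continuous_stieltjesKernel p).aestronglyMeasurable (1 + (p : ℝ)⁻¹)
    (.of_forall fun s => by
      rw [Real.norm_of_nonneg (stieltjesKernel_pos s p).le]; exact stieltjesKernel_le s p)

lemma convex_range_integral_stieltjesKernel :
    Convex ℝ (Set.range fun (σ : ProbabilityMeasure unitInterval) (p : Set.Ioi (0 : ℝ)) =>
      ∫ s, stieltjesKernel s p ∂(σ : Measure unitInterval)) := by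
  rintro _ ⟨σ, rfl⟩ _ ⟨τ, rfl⟩ a b ha hb hab
  have : IsProbabilityMeasure (ENNReal.ofReal a • (σ : Measure unitInterval) +
      ENNReal.ofReal b • (τ : Measure unitInterval)) := ⟨by
    simp [← ENNReal.ofReal_add ha hb, hab]⟩
  refine ⟨⟨_, this⟩, funext fun p => ?_⟩
  simp only [ProbabilityMeasure.coe_mk, Pi.add_apply, Pi.smul_apply]
  rw [integral_add_measure
      ((integrable_stieltjesKernel p _).smul_measure ENNReal.ofReal_ne_top)
      ((integrable_stieltjesKernel p _).smul_measure ENNReal.ofReal_ne_top),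
    integral_smul_measure, integral_smul_measure, ENNReal.toReal_ofReal ha,
    ENNReal.toReal_ofReal hb]

lemma isClosed_range_integral_stieltjesKernel :
    IsClosed (Set.range fun (σ : ProbabilityMeasure unitInterval) (p : Set.Ioi (0 : ℝ)) =>
      ∫ s, stieltjesKernel s p ∂(σ : Measure unitInterval)) := by
  refine (isCompact_range (continuous_pi fun p => ?_)).isClosed
  exact ProbabilityMeasure.continuous_integral_boundedContinuousFunction
    (BoundedContinuousFunction.mkOfCompact ⟨_, continuous_stieltjesKernel p⟩)

lemma exists_integral_of_mem_stieltjesHull {f : Set.Ioi (0 : ℝ) → ℝ} (hf : f ∈ stieltjesHull) :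
    ∃ σ : ProbabilityMeasure unitInterval,
      ∀ p, f p = ∫ s, stieltjesKernel s p ∂(σ : Measure unitInterval) := by
  have hsub : Set.range stieltjesKernel ⊆ Set.range fun (σ : ProbabilityMeasure unitInterval)
      (p : Set.Ioi (0 : ℝ)) => ∫ s, stieltjesKernel s p ∂(σ : Measure unitInterval) := by
    rintro _ ⟨s, rfl⟩
    exact ⟨⟨Measure.dirac s, inferInstance⟩, funext fun p => by simp⟩
  obtain ⟨σ, hσ⟩ := closure_minimal
    (convexHull_min hsub convex_range_integral_stieltjesKernel)
    isClosed_range_integral_stieltjesKernel hf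
  exact ⟨σ, fun p => (congrFun hσ p).symm⟩

lemma integral_comp_simpleFunc {α β : Type*} [MeasurableSpace α] (σ : Measure α)
    [IsFiniteMeasure σ] (φ : SimpleFunc α β) (g : β → ℝ) :
    ∫ x, g (φ x) ∂σ = ∑ y ∈ φ.range, σ.real (φ ⁻¹' {y}) * g y := by
  classical
  have h : ∀ x, g (φ x) = ∑ y ∈ φ.range, (φ ⁻¹' {y}).indicator (fun _ => g y) x := fun x => by
    simp [Set.indicator_apply]
  simp only [h]
  rw [integral_finsetSum _ fun y _ =>
    (integrable_const _).indicator (φ.measurableSet_fiber y)]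
  exact Finset.sum_congr rfl fun y _ => by
    rw [integral_indicator_const _ (φ.measurableSet_fiber y), smul_eq_mul]

lemma integral_mem_stieltjesHull (σ : Measure unitInterval) [IsProbabilityMeasure σ] :
    (fun p => ∫ s, stieltjesKernel s p ∂σ) ∈ stieltjesHull := by
  let φ : ℕ → SimpleFunc unitInterval unitInterval :=
    SimpleFunc.approxOn id measurable_id Set.univ 0 trivial
  refine mem_closure_of_tendsto (b := atTop)
    (f := fun n p => ∫ s, stieltjesKernel (φ n s) p ∂σ) (tendsto_pi_nhds.2 fun p => ?_)
    (.of_forall fun n => ?_)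
  · refine tendsto_integral_of_dominated_convergence (fun _ => 1 + (p : ℝ)⁻¹) (fun n => ?_)
      (integrable_const _) (fun n => .of_forall fun s => ?_) (.of_forall fun s => ?_)
    · exact ((continuous_stieltjesKernel p).measurable.comp
        (φ n).measurable).aestronglyMeasurable
    · rw [Real.norm_of_nonneg (stieltjesKernel_pos _ p).le]
      exact stieltjesKernel_le _ p
    · exact ((continuous_stieltjesKernel p).tendsto s).comp
        (SimpleFunc.tendsto_approxOn measurable_id (Set.mem_univ _) (by simp))
  · have h : (fun p => ∫ s, stieltjesKernel (φ n s) p ∂σ) =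
        ∑ t ∈ (φ n).range, σ.real (φ n ⁻¹' {t}) • stieltjesKernel t := by
      funext p
      simp [integral_comp_simpleFunc σ (φ n) fun t => stieltjesKernel t p]
    rw [h]
    refine (convex_convexHull ℝ _).sum_mem (fun _ _ => measureReal_nonneg) ?_
      fun t _ => subset_convexHull ℝ _ ⟨t, rfl⟩
    simpa using (integral_comp_simpleFunc σ (φ n) fun _ => 1).symm

lemma le_of_mem_stieltjesHull {f : Set.Ioi (0 : ℝ) → ℝ} (hf : f ∈ stieltjesHull)
    (p : Set.Ioi (0 : ℝ)) : (1 + (p : ℝ))⁻¹ ≤ f p := by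
  obtain ⟨σ, hσ⟩ := exists_integral_of_mem_stieltjesHull hf
  rw [hσ]
  simpa using integral_mono (integrable_const _) (integrable_stieltjesKernel p σ)
    fun s => le_stieltjesKernel s p

lemma pos_of_mem_stieltjesHull {f : Set.Ioi (0 : ℝ) → ℝ} (hf : f ∈ stieltjesHull)
    (p : Set.Ioi (0 : ℝ)) : 0 < f p :=
  have hp : 0 < (p : ℝ) := p.2
  lt_of_lt_of_le (by positivity) (le_of_mem_stieltjesHull hf p)

lemma convex_stieltjesHull : Convex ℝ stieltjesHull := (convex_convexHull ℝ _).closure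

lemma inv_mul_mem_stieltjesHull {f : Set.Ioi (0 : ℝ) → ℝ} (hf : f ∈ stieltjesHull) :
    (fun p : Set.Ioi (0 : ℝ) => ((p : ℝ) * f p)⁻¹) ∈ stieltjesHull := by
  have hcont : ContinuousAt (fun (f : Set.Ioi (0 : ℝ) → ℝ) (p : Set.Ioi (0 : ℝ)) =>
      ((p : ℝ) * f p)⁻¹) f :=
    continuousAt_pi.2 fun p => ContinuousAt.inv₀
      (continuous_const.mul (continuous_apply p)).continuousAt
      (mul_pos p.2 (pos_of_mem_stieltjesHull hf p)).ne'
  refine closure_mono ?_ (hcont.continuousWithinAt.mem_closure_image hf)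
  rintro _ ⟨g, hg, rfl⟩
  obtain ⟨ι, _, τ, z, hτ, hsum, hz, rfl⟩ := mem_convexHull_iff_exists_fintype.1 hg
  choose s hs using hz
  obtain ⟨n, c, t, hc, ht, hle, h⟩ :=
    exists_inv_mul_sum_eq τ (fun i => (s i : ℝ)) hτ hsum fun i => (s i).2
  have h' : (fun p : Set.Ioi (0 : ℝ) => ((p : ℝ) * (∑ i, τ i • z i) p)⁻¹) =
      ∑ k : Option (Fin n), k.elim (1 - ∑ k, c k) c •
        stieltjesKernel (k.elim 0 fun k => ⟨t k, ht k⟩) := by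
    funext p
    have := h p p.2
    simpa [stieltjesKernel, ← hs, Fintype.sum_option] using this
  beta_reduce
  rw [h']
  refine (convex_convexHull ℝ _).sum_mem (fun k _ => ?_) ?_
    fun t _ => subset_convexHull ℝ _ ⟨_, rfl⟩
  · cases k
    · simpa using hle
    · exact hc _
  · simp [Fintype.sum_option]

lemma abs_sub_sqrt_mul_le {a b : ℝ} (ha : 0 < a) (hb : 0 < b) : |a - √(a * b)| ≤ |a - b| := by
  rcases le_total a b with h | h
  · have h1 : a ≤ √(a * b) := Real.le_sqrt_of_sq_le (by nlinarith)
    have h2 : √(a * b) ≤ b := Real.sqrt_le_iff.2 ⟨hb.le, by nlinarith⟩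
    rw [abs_of_nonpos (by linarith), abs_of_nonpos (by linarith)]
    linarith
  · have h1 : b ≤ √(a * b) := Real.le_sqrt_of_sq_le (by nlinarith)
    have h2 : √(a * b) ≤ a := Real.sqrt_le_iff.2 ⟨ha.le, by nlinarith⟩
    rw [abs_of_nonneg (by linarith), abs_of_nonneg (by linarith)]
    linarith

/-- The arithmetic-harmonic mean iteration stays among the normalised Stieltjes functions. -/
lemma sqrt_mem_stieltjesHull {f : Set.Ioi (0 : ℝ) → ℝ} (hf : f ∈ stieltjesHull) :
    (fun p => √(f p)) ∈ stieltjesHull := by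
  have key : ∀ n : ℕ, ∃ y ∈ stieltjesHull, ∃ z ∈ stieltjesHull,
      ∀ p, y p * z p = f p ∧ |y p - z p| ≤ |1 - f p| / 2 ^ n := by
    intro n
    induction n with
    | zero =>
      refine ⟨stieltjesKernel 0, subset_closure (subset_convexHull ℝ _ ⟨0, rfl⟩), f, hf,
        fun p => ?_⟩
      simp [stieltjesKernel]
    | succ n ih =>
      obtain ⟨y, hy, z, hz, h⟩ := ih
      refine ⟨_, convex_stieltjesHull hy hz one_half_pos.le one_half_pos.le (add_halves 1), _,
        inv_mul_mem_stieltjesHull (convex_stieltjesHull (inv_mul_mem_stieltjesHull hy)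
          (inv_mul_mem_stieltjesHull hz) one_half_pos.le one_half_pos.le (add_halves 1)),
        fun p => ?_⟩
      have hp : 0 < (p : ℝ) := p.2
      have hyp := pos_of_mem_stieltjesHull hy p
      have hzp := pos_of_mem_stieltjesHull hz p
      obtain ⟨h1, h2⟩ := h p
      have e : ((p : ℝ) * ((1 / 2 : ℝ) • (fun p : Set.Ioi (0 : ℝ) => ((p : ℝ) * y p)⁻¹) +
          (1 / 2 : ℝ) • (fun p : Set.Ioi (0 : ℝ) => ((p : ℝ) * z p)⁻¹)) p)⁻¹ =
          2 * y p * z p / (y p + z p) := by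
        simp only [Pi.add_apply, Pi.smul_apply, smul_eq_mul]
        field_simp
        ring
      rw [e]
      simp only [Pi.add_apply, Pi.smul_apply, smul_eq_mul]
      refine ⟨by rw [← h1]; field_simp, ?_⟩
      have e2 : 1 / 2 * y p + 1 / 2 * z p - 2 * y p * z p / (y p + z p) =
          |y p - z p| * (|y p - z p| / (y p + z p)) / 2 := by
        rw [mul_div_assoc', ← sq, sq_abs]
        field_simp
        ring
      have e3 : |y p - z p| / (y p + z p) ≤ 1 :=
        (div_le_one (by positivity)).2 (abs_le.2 ⟨by linarith, by linarith⟩)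
      rw [e2, abs_of_nonneg (by positivity), pow_succ, ← div_div]
      gcongr
      exact (mul_le_of_le_one_right (abs_nonneg _) e3).trans h2
  choose y hy z hz h using key
  refine isClosed_closure.mem_of_tendsto (b := atTop) (f := y) (tendsto_pi_nhds.2 fun p => ?_)
    (.of_forall hy)
  rw [tendsto_iff_norm_sub_tendsto_zero]
  have hlim : Tendsto (fun n : ℕ => |1 - f p| / 2 ^ n) atTop (𝓝 0) :=
    tendsto_const_nhds.div_atTop (tendsto_pow_atTop_atTop_of_one_lt one_lt_two)
  refine squeeze_zero (fun _ => norm_nonneg _) (fun n => ?_) hlim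
  rw [Real.norm_eq_abs, ← (h n p).1]
  exact (abs_sub_sqrt_mul_le (pos_of_mem_stieltjesHull (hy n) p)
    (pos_of_mem_stieltjesHull (hz n) p)).trans ((h n p).1 ▸ (h n p).2)

lemma inv_add_eq_mul_stieltjesKernel {r : ℝ} (hr : 0 ≤ r) {s : unitInterval}
    (hs : (s : ℝ) = (1 + r)⁻¹) (p : Set.Ioi (0 : ℝ)) :
    ((p : ℝ) + r)⁻¹ = (1 + r)⁻¹ * stieltjesKernel s p := by
  have hp : 0 < (p : ℝ) := p.2
  rw [stieltjesKernel, hs, ← mul_inv]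
  congr 1
  field_simp
  ring

/-- The change of variables `r ↦ (1 + r)⁻¹`, extended to all of `ℝ` by clamping. -/
noncomputable def compactify (r : ℝ) : unitInterval := Set.projIcc 0 1 zero_le_one (1 + r)⁻¹

lemma measurable_compactify : Measurable compactify :=
  continuous_projIcc.measurable.comp (by fun_prop)

lemma coe_compactify {r : ℝ} (hr : 0 ≤ r) : (compactify r : ℝ) = (1 + r)⁻¹ := by
  rw [compactify, Set.projIcc_of_mem zero_le_one
    ⟨by positivity, inv_le_one_of_one_le₀ (by linarith)⟩]

lemma integrableOn_inv_add {μ : Measure ℝ}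
    (hμ : IntegrableOn (fun r : ℝ => (1 + r)⁻¹) (Set.Ici 0) μ) {p : ℝ} (hp : 0 < p) :
    IntegrableOn (fun r : ℝ => (p + r)⁻¹) (Set.Ici 0) μ := by
  have h : IntegrableOn (fun r : ℝ => (1 + r)⁻¹ * stieltjesKernel (compactify r) ⟨p, hp⟩)
      (Set.Ici 0) μ := by
    refine Integrable.mul_bdd (c := 1 + p⁻¹) hμ ?_ (.of_forall fun r => ?_)
    · exact ((continuous_stieltjesKernel _).measurable.comp
        measurable_compactify).aestronglyMeasurable
    · rw [Real.norm_of_nonneg (stieltjesKernel_pos _ _).le]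
      exact stieltjesKernel_le _ ⟨p, hp⟩
  exact h.congr_fun (fun r hr =>
    (inv_add_eq_mul_stieltjesKernel hr (coe_compactify hr) ⟨p, hp⟩).symm) measurableSet_Ici

lemma setIntegral_div_mem_stieltjesHull {μ : Measure ℝ}
    (hμ : IntegrableOn (fun r : ℝ => (1 + r)⁻¹) (Set.Ici 0) μ)
    {q : ℝ} (hq : 0 < q) (hμq : ∫ r in Set.Ici (0 : ℝ), (1 + r)⁻¹ ∂μ = q) :
    (fun p : Set.Ioi (0 : ℝ) => (∫ r in Set.Ici (0 : ℝ), ((p : ℝ) + r)⁻¹ ∂μ) / q) ∈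
      stieltjesHull := by
  have hmeas : Measurable fun r : ℝ => ENNReal.ofReal ((1 + r)⁻¹ / q) := by fun_prop
  set m : Measure ℝ := (μ.restrict (Set.Ici 0)).withDensity
    fun r => ENNReal.ofReal ((1 + r)⁻¹ / q) with hm
  have hprob : IsProbabilityMeasure m := ⟨by
    rw [hm, withDensity_apply _ MeasurableSet.univ, Measure.restrict_univ,
      ← ofReal_integral_eq_lintegral_ofReal (hμ.div_const q), integral_div, hμq,
      div_self hq.ne', ENNReal.ofReal_one]
    exact (ae_restrict_iff' measurableSet_Ici).2 (.of_forall fun r (hr : 0 ≤ r) => by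
      simp only [Pi.zero_apply]; positivity)⟩
  have := Measure.isProbabilityMeasure_map (μ := m) measurable_compactify.aemeasurable
  convert integral_mem_stieltjesHull (m.map compactify) using 2 with p
  rw [integral_map measurable_compactify.aemeasurable
    (continuous_stieltjesKernel p).aestronglyMeasurable, hm,
    integral_withDensity_eq_integral_toReal_smul hmeas
      (.of_forall fun _ => ENNReal.ofReal_lt_top), ← integral_div]
  refine setIntegral_congr_fun measurableSet_Ici fun r (hr : 0 ≤ r) => ?_
  have h : 0 ≤ (1 + r)⁻¹ / q := by positivity
  simp only [ENNReal.toReal_ofReal h, smul_eq_mul]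
  rw [inv_add_eq_mul_stieltjesKernel hr (coe_compactify hr) p]
  ring

lemma integral_stieltjesKernel_eq_add {σ : Measure unitInterval} [IsFiniteMeasure σ]
    (h1 : σ {1} = 0) (p : Set.Ioi (0 : ℝ)) :
    ∫ s, stieltjesKernel s p ∂σ = σ.real {0} + ∫ s in Set.Ioo 0 1, stieltjesKernel s p ∂σ := by
  have hint := integrable_stieltjesKernel p σ
  have h2 : ((Set.Ioo 0 1)ᶜ : Set unitInterval) =ᵐ[σ] ({0} : Set unitInterval) := by
    have : ({1} : Set unitInterval)ᶜ ∈ ae σ := compl_mem_ae_iff.2 h1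
    filter_upwards [this] with s hs
    refine propext ⟨fun h => ?_, fun h => ?_⟩
    · by_contra h0
      exact h ⟨unitInterval.pos_iff_ne_zero.2 h0, unitInterval.lt_one_iff_ne_one.2 hs⟩
    · rintro ⟨h0, -⟩
      exact h0.ne' h
  rw [← integral_add_compl (s := Set.Ioo 0 1) measurableSet_Ioo hint, setIntegral_congr_set h2,
    integral_singleton, add_comm]
  simp [stieltjesKernel]

lemma exists_measure_of_integral_stieltjesKernel {σ : Measure unitInterval} [IsFiniteMeasure σ]
    (h1 : σ {1} = 0) :
    ∃ ν : Measure ℝ, IntegrableOn (fun r : ℝ => (1 + r)⁻¹) (Set.Ioi 0) ν ∧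
      ∀ p : Set.Ioi (0 : ℝ), ∫ s, stieltjesKernel s p ∂σ =
        σ.real {0} + ∫ r in Set.Ioi (0 : ℝ), ((p : ℝ) + r)⁻¹ ∂ν := by
  set ψ : unitInterval → ℝ := fun s => (1 - (s : ℝ)) / s with hψ
  have hψm : Measurable ψ := by fun_prop
  have hpre : ψ ⁻¹' Set.Ioi 0 = Set.Ioo 0 1 := by
    ext s
    simp only [hψ, Set.mem_preimage, Set.mem_Ioi, Set.mem_Ioo]
    refine ⟨fun h => ⟨?_, ?_⟩, fun h => div_pos (sub_pos.2 h.2) h.1⟩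
    · refine unitInterval.pos_iff_ne_zero.2 ?_
      rintro rfl
      simp at h
    · refine unitInterval.lt_one_iff_ne_one.2 ?_
      rintro rfl
      simp at h
  have hdens : Measurable fun s : unitInterval => ENNReal.ofReal (s : ℝ)⁻¹ := by fun_prop
  have hkey : ∀ p : Set.Ioi (0 : ℝ), ∀ s ∈ Set.Ioo (0 : unitInterval) 1,
      (ENNReal.ofReal (s : ℝ)⁻¹).toReal • ((p : ℝ) + ψ s)⁻¹ = stieltjesKernel s p := by
    rintro p s ⟨hs0, -⟩
    have hs : 0 < (s : ℝ) := hs0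
    rw [ENNReal.toReal_ofReal (by positivity), smul_eq_mul, ← mul_inv, stieltjesKernel]
    congr 1
    simp only [hψ]
    field_simp
    ring
  refine ⟨(σ.withDensity fun s => ENNReal.ofReal (s : ℝ)⁻¹).map ψ, ?_, fun p => ?_⟩
  · rw [IntegrableOn, Measure.restrict_map hψm measurableSet_Ioi, hpre,
      restrict_withDensity measurableSet_Ioo,
      integrable_map_measure (by fun_prop) hψm.aemeasurable,
      integrable_withDensity_iff_integrable_smul' hdens
        (.of_forall fun _ => ENNReal.ofReal_lt_top)]
    exact IntegrableOn.congr_fun (integrable_stieltjesKernel ⟨1, Set.mem_Ioi.2 one_pos⟩ σ).integrableOn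
      (fun s hs => (hkey ⟨1, Set.mem_Ioi.2 one_pos⟩ s hs).symm) measurableSet_Ioo
  · rw [integral_stieltjesKernel_eq_add h1, setIntegral_map measurableSet_Ioi
      (by fun_prop) hψm.aemeasurable, hpre, restrict_withDensity measurableSet_Ioo,
      integral_withDensity_eq_integral_toReal_smul hdens
        (.of_forall fun _ => ENNReal.ofReal_lt_top)]
    congr 1
    exact setIntegral_congr_fun measurableSet_Ioo fun s hs => (hkey p s hs).symm

lemma tendsto_integral_inv_atTop (σ : Measure unitInterval) [IsFiniteMeasure σ] :
    Tendsto (fun p : ℝ => ∫ s : unitInterval, (1 - (s : ℝ) + p * s)⁻¹ ∂σ) atTop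
      (𝓝 (σ.real {0})) := by
  have h : ∫ s, ({0} : Set unitInterval).indicator (fun _ => (1 : ℝ)) s ∂σ = σ.real {0} := by
    rw [integral_indicator_const _ (measurableSet_singleton _), smul_eq_mul, mul_one]
  rw [← h]
  refine tendsto_integral_filter_of_dominated_convergence (fun _ => 1) ?_ ?_
    (integrable_const _) (.of_forall fun s => ?_)
  · exact .of_forall fun p => Measurable.aestronglyMeasurable (by fun_prop)
  · filter_upwards [eventually_ge_atTop 1] with p hp
    refine .of_forall fun s => ?_
    have : 1 ≤ 1 - (s : ℝ) + p * s := by nlinarith [s.2.1]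
    rw [Real.norm_of_nonneg (by positivity)]
    exact inv_le_one_of_one_le₀ this
  · by_cases hs : s = 0
    · simp [hs]
    · have hs' : 0 < (s : ℝ) := unitInterval.pos_iff_ne_zero.2 hs
      rw [Set.indicator_of_notMem (by simpa using hs)]
      exact tendsto_inv_atTop_zero.comp
        (tendsto_atTop_add_const_left _ _ (tendsto_id.atTop_mul_const hs'))

/-- A bounded Stieltjes function has no pole at the origin. -/
lemma measure_singleton_one_eq_zero_of_bounded {σ : Measure unitInterval} [IsFiniteMeasure σ]
    {M : ℝ} (hM : ∀ p, ∫ s, stieltjesKernel s p ∂σ ≤ M) : σ {1} = 0 := by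
  have hle : ∀ p : Set.Ioi (0 : ℝ), σ.real {1} ≤ M * p := fun p => by
    have hp : 0 < (p : ℝ) := p.2
    have h := setIntegral_le_integral (s := {1}) (integrable_stieltjesKernel p σ)
      (.of_forall fun s => (stieltjesKernel_pos s p).le)
    rw [integral_singleton] at h
    have h' := h.trans (hM p)
    simp only [stieltjesKernel, Set.Icc.coe_one, sub_self, mul_one, zero_add,
      smul_eq_mul] at h'
    rwa [← div_eq_mul_inv, div_le_iff₀ hp] at h'
  have hlim : Tendsto (fun p : ℝ => M * p) (𝓝[>] 0) (𝓝 0) := by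
    simpa using ((continuous_const_mul M).tendsto 0).mono_left nhdsWithin_le_nhds
  have h0 : σ.real {1} ≤ 0 := ge_of_tendsto hlim
    (eventually_mem_nhdsWithin.mono fun p hp => hle ⟨p, hp⟩)
  exact (measureReal_eq_zero_iff).1 (le_antisymm h0 measureReal_nonneg)

/-- Structural result of Section 3 of the paper: for a viscoelastic medium with density
`ρ > 0`, positive relaxation spectrum `μ` and positive equilibrium modulus `μ({0}) > 0`,
the wave-number function `B(p) = p ρ^{1/2} / Q(p)^{1/2}`, with
`Q(p) = μ({0}) + p ∫_{(0,∞)} (p+r)⁻¹ μ(dr)`, decomposes as `B(p) = c p + b(p)` where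
`c ≥ 0` and `b(p) = p ∫_{(0,∞)} (p+r)⁻¹ ν(dr)` is an admissible dispersion-attenuation
function; moreover `c = lim_{p→∞} B(p)/p`. -/
theorem wave_number_decomposition (ρ : ℝ) (hρ : 0 < ρ) (μ : Measure ℝ)
    (hμ : IntegrableOn (fun r : ℝ => (1 + r)⁻¹) (Set.Ici 0) μ)
    (h0 : 0 < μ {0})
    (Q B : ℝ → ℝ)
    (hQ : ∀ p : ℝ, 0 < p →
      Q p = (μ {0}).toReal + p * ∫ r in Set.Ioi (0 : ℝ), (p + r)⁻¹ ∂μ)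
    (hB : ∀ p : ℝ, 0 < p → B p = p * Real.sqrt ρ / Real.sqrt (Q p)) :
    ∃ c : ℝ, 0 ≤ c ∧ ∃ ν : Measure ℝ,
      IntegrableOn (fun r : ℝ => (1 + r)⁻¹) (Set.Ioi 0) ν ∧
      (∀ p : ℝ, 0 < p →
        B p = c * p + p * ∫ r in Set.Ioi (0 : ℝ), (p + r)⁻¹ ∂ν) ∧
      Tendsto (fun p : ℝ => B p / p) atTop (𝓝 c) := by
  have hfin : μ {0} < ⊤ := by
    have := hμ.mono_set (t := Set.Ici 0) (s := {0}) (by simp)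
    simpa using this
  have hm : 0 < (μ {0}).toReal := ENNReal.toReal_pos h0.ne' hfin.ne
  have hQm : ∀ p : ℝ, 0 < p → (μ {0}).toReal ≤ Q p := fun p hp => by
    rw [hQ p hp, le_add_iff_nonneg_right]
    exact mul_nonneg hp.le (setIntegral_nonneg measurableSet_Ioi fun r (hr : 0 < r) => by
      positivity)
  have hQ' : ∀ p : ℝ, 0 < p → Q p = p * ∫ r in Set.Ici (0 : ℝ), (p + r)⁻¹ ∂μ := fun p hp => by
    have hint := integrableOn_inv_add hμ hp
    have hIci : Set.Ici (0 : ℝ) = {0} ∪ Set.Ioi 0 := by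
      rw [Set.union_comm, Set.Ioi_union_left]
    rw [hQ p hp, hIci, setIntegral_union (by simp) measurableSet_Ioi
      (hint.mono_set (by simp)) (hint.mono_set Set.Ioi_subset_Ici_self), integral_singleton,
      Measure.real, smul_eq_mul, add_zero]
    field_simp
  set q := Q 1 with hq
  have hqpos : 0 < q := hm.trans_le (hQm 1 one_pos)
  have hmem := sqrt_mem_stieltjesHull (inv_mul_mem_stieltjesHull
    (setIntegral_div_mem_stieltjesHull hμ hqpos (by rw [hq, hQ' 1 one_pos, one_mul])))
  obtain ⟨σ, hσ⟩ := exists_integral_of_mem_stieltjesHull hmem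
  have hσQ : ∀ p : Set.Ioi (0 : ℝ),
      ∫ s, stieltjesKernel s p ∂(σ : Measure unitInterval) = √(q / Q p) := fun p => by
    rw [← hσ, mul_div_assoc', ← hQ' p p.2, inv_div]
  have hσ1 : (σ : Measure unitInterval) {1} = 0 :=
    measure_singleton_one_eq_zero_of_bounded (M := √(q / (μ {0}).toReal)) fun p => by
      rw [hσQ]
      have := hQm p p.2
      gcongr
  set C := √(ρ / q)
  set σC : Measure unitInterval := ENNReal.ofReal C • (σ : Measure unitInterval) with hσC
  have hfinC : IsFiniteMeasure σC := Measure.smul_finite _ ENNReal.ofReal_ne_top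
  have hBσ : ∀ p : Set.Ioi (0 : ℝ), B p / p = ∫ s, stieltjesKernel s p ∂σC := fun p => by
    have hp : 0 < (p : ℝ) := p.2
    rw [hσC, integral_smul_measure, ENNReal.toReal_ofReal (Real.sqrt_nonneg _), hσQ,
      smul_eq_mul, ← Real.sqrt_mul (by positivity), div_mul_div_cancel₀ hqpos.ne',
      Real.sqrt_div hρ.le, hB p hp, mul_div_assoc, mul_div_cancel_left₀ _ hp.ne']
  obtain ⟨ν, hν, hνσ⟩ := exists_measure_of_integral_stieltjesKernel (σ := σC) (by simp [σC, hσ1])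
  refine ⟨σC.real {0}, measureReal_nonneg, ν, hν, fun p hp => ?_, ?_⟩
  · have h := (hBσ ⟨p, hp⟩).trans (hνσ ⟨p, hp⟩)
    rw [div_eq_iff hp.ne'] at h
    rw [h]
    ring
  · refine (tendsto_integral_inv_atTop σC).congr' ?_
    filter_upwards [eventually_gt_atTop 0] with p hp
    exact (hBσ ⟨p, hp⟩).symm
end

section
/- Let z be a complex number with Im z ≥ 0, z ≠ 0, and 1 + z ∉ (−∞,0]. Then the principal logarithm satisfies 0 ≤ Im Log(1+z) ≤ π; moreover, for every α with 0 < α ≤ 1, the principal power w^α of w = Log(1+z) satisfies Im((Log(1+z))^α) ≥ 0. In particular the map z ↦ (Log(1+z))^α sends the closed upper half-plane (minus the excluded set) into the closed upper half-plane. -/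
open MeasureTheory Filter Topology Complex

/-- Principal powers with exponent in `[0, 1]` preserve the closed upper half-plane. -/
theorem cpow_ofReal_im_nonneg {w : ℂ} (hw : 0 ≤ w.im) {α : ℝ} (h0 : 0 ≤ α) (h1 : α ≤ 1) :
    0 ≤ (w ^ (α : ℂ)).im := by
  rw [Complex.cpow_ofReal_im]
  have harg : 0 ≤ arg w := Complex.arg_nonneg_iff.2 hw
  refine mul_nonneg (by positivity) (Real.sin_nonneg_of_nonneg_of_le_pi (by positivity) ?_)
  exact (mul_le_of_le_one_right harg h1).trans (Complex.arg_le_pi w)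

/-- For complex `z` with `Im z ≥ 0`, `z ≠ 0` and `1 + z` off the cut `(−∞,0]`, the
principal logarithm satisfies `0 ≤ Im Log(1+z) ≤ π`, and for every `0 < α ≤ 1` the
principal power satisfies `Im ((Log(1+z))^α) ≥ 0`; i.e. `z ↦ (Log(1+z))^α` maps the
closed upper half-plane into itself. -/
theorem log_one_add_upper_half_plane (z : ℂ) (hz : 0 ≤ z.im) (hz0 : z ≠ 0)
    (hslit : 1 + z ∈ Complex.slitPlane) :
    0 ≤ (Complex.log (1 + z)).im ∧ (Complex.log (1 + z)).im ≤ Real.pi ∧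
    ∀ α : ℝ, 0 < α → α ≤ 1 →
      0 ≤ ((Complex.log (1 + z)) ^ ((α : ℂ))).im := by
  have him : 0 ≤ (Complex.log (1 + z)).im := by
    rw [Complex.log_im, Complex.arg_nonneg_iff]
    simpa using hz
  exact ⟨him, Complex.log_im_le_pi _, fun _ h0 h1 => cpow_ofReal_im_nonneg him h0.le h1⟩
end

section
/- Let a > 0, c₀ > 0 and 0 < α < 1, and define f(t) = 1 + 2 c₀ a t^{1−α}/Γ(2−α) + c₀² a² t^{2(1−α)}/Γ(3−2α) for t > 0. Then f is a Bernstein function — i.e. f ≥ 0 on (0,∞) and (−1)ⁿ f^{(n+1)}(t) ≥ 0 for all integers n ≥ 0 and all t > 0 — if and only if 1/2 ≤ α < 1. -/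
open MeasureTheory Filter Topology

/-- The iterated derivatives on `(0, ∞)` of a combination of a constant and two real powers. -/
lemma iteratedDeriv_succ_const_add_rpow_add_rpow {f : ℝ → ℝ} {C A B r s : ℝ}
    (hf : ∀ t : ℝ, 0 < t → f t = C + A * t ^ r + B * t ^ s) (n : ℕ) {t : ℝ} (ht : 0 < t) :
    iteratedDeriv (n + 1) f t =
      A * ((∏ i ∈ Finset.range (n + 1), (r - i)) * t ^ (r - (n + 1)))
        + B * ((∏ i ∈ Finset.range (n + 1), (s - i)) * t ^ (s - (n + 1))) := by
  induction n generalizing t with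
  | zero =>
    have heq : f =ᶠ[𝓝 t] fun x => C + A * x ^ r + B * x ^ s := by
      filter_upwards [Ioi_mem_nhds ht] with x hx using hf x hx
    have hd := (((Real.hasDerivAt_rpow_const (p := r) (Or.inl ht.ne')).const_mul A).const_add
      C).add ((Real.hasDerivAt_rpow_const (p := s) (Or.inl ht.ne')).const_mul B)
    rw [zero_add, iteratedDeriv_one, heq.deriv_eq]
    refine hd.deriv.trans ?_
    simp
  | succ n ih =>
    rw [iteratedDeriv_succ]
    have heq : iteratedDeriv (n + 1) f =ᶠ[𝓝 t] fun x =>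
        A * ((∏ i ∈ Finset.range (n + 1), (r - i)) * x ^ (r - (n + 1)))
          + B * ((∏ i ∈ Finset.range (n + 1), (s - i)) * x ^ (s - (n + 1))) := by
      filter_upwards [Ioi_mem_nhds ht] with x hx using ih hx
    have hd := (((Real.hasDerivAt_rpow_const (p := r - (n + 1)) (Or.inl ht.ne')).const_mul
      (∏ i ∈ Finset.range (n + 1), (r - (i : ℝ)))).const_mul A).add
      (((Real.hasDerivAt_rpow_const (p := s - (n + 1)) (Or.inl ht.ne')).const_mul
      (∏ i ∈ Finset.range (n + 1), (s - (i : ℝ)))).const_mul B)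
    rw [heq.deriv_eq]
    refine hd.deriv.trans ?_
    rw [Finset.prod_range_succ _ (n + 1), Finset.prod_range_succ _ (n + 1)]
    push_cast
    rw [sub_sub r, sub_sub s]
    ring

lemma neg_one_pow_mul_prod_range_sub_nonneg {r : ℝ} (h0 : 0 ≤ r) (h1 : r ≤ 1) (n : ℕ) :
    0 ≤ (-1 : ℝ) ^ n * ∏ i ∈ Finset.range (n + 1), (r - i) := by
  induction n with
  | zero => simpa using h0
  | succ n ih =>
    have hn : (0 : ℝ) ≤ (n + 1) - r := by
      have : (0 : ℝ) ≤ n := n.cast_nonneg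
      linarith
    rw [Finset.prod_range_succ, pow_succ]
    push_cast
    linarith [mul_nonneg ih hn]

/-- For `a, c₀ > 0` and `0 < α < 1`, the function
`f(t) = 1 + 2 c₀ a t^{1−α}/Γ(2−α) + c₀² a² t^{2(1−α)}/Γ(3−2α)` is a Bernstein function
(`f ≥ 0` on `(0,∞)` and `(−1)ⁿ f^{(n+1)}(t) ≥ 0` for all `n ≥ 0`, `t > 0`) if and only
if `1/2 ≤ α < 1`. -/
theorem bernstein_iff_alpha_ge_half (a c₀ α : ℝ) (ha : 0 < a) (hc : 0 < c₀)
    (hα0 : 0 < α) (hα1 : α < 1)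
    (f : ℝ → ℝ)
    (hf : ∀ t : ℝ, 0 < t →
      f t = 1 + 2 * c₀ * a * t ^ (1 - α) / Real.Gamma (2 - α)
        + c₀ ^ 2 * a ^ 2 * t ^ (2 * (1 - α)) / Real.Gamma (3 - 2 * α)) :
    ((∀ t : ℝ, 0 < t → 0 ≤ f t) ∧
      ∀ n : ℕ, ∀ t : ℝ, 0 < t → 0 ≤ (-1 : ℝ) ^ n * iteratedDeriv (n + 1) f t)
    ↔ 1 / 2 ≤ α := by
  set A : ℝ := 2 * c₀ * a / Real.Gamma (2 - α) with hA
  set B : ℝ := c₀ ^ 2 * a ^ 2 / Real.Gamma (3 - 2 * α) with hB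
  have hΓ₁ : 0 < Real.Gamma (2 - α) := Real.Gamma_pos_of_pos (by linarith)
  have hΓ₂ : 0 < Real.Gamma (3 - 2 * α) := Real.Gamma_pos_of_pos (by linarith)
  have hApos : 0 < A := by positivity
  have hBpos : 0 < B := by positivity
  have hf' : ∀ t : ℝ, 0 < t → f t = 1 + A * t ^ (1 - α) + B * t ^ (2 * (1 - α)) := by
    intro t ht
    rw [hf t ht, hA, hB]
    ring
  constructor
  · rintro ⟨-, h⟩
    by_contra! hα
    have hlim : Tendsto (fun t : ℝ => t ^ (1 - α)) atTop atTop :=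
      tendsto_rpow_atTop (by linarith)
    set D : ℝ := B * ((2 * (1 - α)) * (2 * (1 - α) - 1)) with hD
    have hDpos : 0 < D := mul_pos hBpos (mul_pos (by linarith) (by linarith))
    obtain ⟨t, hlt, ht⟩ := ((hlim.eventually_gt_atTop (A * ((1 - α) * α) / D)).and
      (eventually_gt_atTop 0)).exists
    have h2 := h 1 t ht
    rw [iteratedDeriv_succ_const_add_rpow_add_rpow hf' 1 ht] at h2
    have hpow : t ^ (2 * (1 - α) - ((1 : ℕ) + 1)) = t ^ (1 - α) * t ^ (1 - α - ((1 : ℕ) + 1)) := by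
      rw [← Real.rpow_add ht]
      congr 1
      ring
    rw [hpow] at h2
    have hp : 0 < t ^ (1 - α - ((1 : ℕ) + 1)) := Real.rpow_pos_of_pos ht _
    rw [div_lt_iff₀ hDpos] at hlt
    have h3 := mul_pos hp (sub_pos.mpr hlt)
    simp only [Finset.prod_range_succ, Finset.prod_range_zero] at h2
    push_cast at h2 h3
    rw [hD] at h3
    linarith
  · intro hα
    refine ⟨fun t ht => ?_, fun n t ht => ?_⟩
    · rw [hf' t ht]
      positivity
    · rw [iteratedDeriv_succ_const_add_rpow_add_rpow hf' n ht]
      have h₁ := neg_one_pow_mul_prod_range_sub_nonneg (r := 1 - α) (by linarith) (by linarith) n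
      have h₂ := neg_one_pow_mul_prod_range_sub_nonneg (r := 2 * (1 - α)) (by linarith)
        (by linarith) n
      have h₃ := mul_nonneg hApos.le (mul_nonneg h₁ (Real.rpow_nonneg ht.le (1 - α - (n + 1))))
      have h₄ := mul_nonneg hBpos.le
        (mul_nonneg h₂ (Real.rpow_nonneg ht.le (2 * (1 - α) - (n + 1))))
      linarith
end

section
/- Let ρ, G₀, η, ω > 0. Then, with the principal branch of the complex square root, Re( −iω · √(ρ/(G₀ − i η ω)) ) = √( ρ ω² (√(G₀² + η² ω²) − G₀) / (2 (G₀² + η² ω²)) ). -/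
open MeasureTheory Filter Topology

/-- Closed form for the Voigt-model attenuation function: for `ρ, G₀, η, ω > 0`, with
the principal branch of the complex square root,
`Re(−iω √(ρ/(G₀ − i η ω))) = √(ρ ω² (√(G₀² + η² ω²) − G₀) / (2 (G₀² + η² ω²)))`. -/
theorem voigt_attenuation (ρ G₀ η ω : ℝ)
    (hρ : 0 < ρ) (hG : 0 < G₀) (hη : 0 < η) (hω : 0 < ω) :
    (-(Complex.I * (ω : ℂ)) *
        ((ρ : ℂ) / ((G₀ : ℂ) - Complex.I * (η : ℂ) * (ω : ℂ))) ^ ((1 : ℂ) / 2)).re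
      = Real.sqrt (ρ * ω ^ 2 * (Real.sqrt (G₀ ^ 2 + η ^ 2 * ω ^ 2) - G₀)
          / (2 * (G₀ ^ 2 + η ^ 2 * ω ^ 2))) := by
  set D : ℝ := G₀ ^ 2 + η ^ 2 * ω ^ 2 with hD
  have hD0 : 0 < D := by positivity
  have hz : (ρ : ℂ) / ((G₀ : ℂ) - Complex.I * (η : ℂ) * (ω : ℂ))
      = ⟨ρ * G₀ / D, ρ * (η * ω) / D⟩ := by
    apply Complex.ext <;>
      simp [Complex.div_re, Complex.div_im, Complex.normSq_apply] <;>
      rw [hD] <;> ring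
  have him : 0 ≤ ρ * (η * ω) / D := by positivity
  have hnorm : ‖(⟨ρ * G₀ / D, ρ * (η * ω) / D⟩ : ℂ)‖ = ρ * √D / D := by
    rw [Complex.norm_def, Complex.normSq_mk, Real.sqrt_eq_iff_mul_self_eq_of_pos]
    · field_simp
      rw [Real.sq_sqrt hD0.le, hD]
    · positivity
  have hre (w : ℂ) : (-(Complex.I * (ω : ℂ)) * w).re = ω * w.im := by simp
  rw [hz, one_div, hre, Complex.cpow_inv_two_im_eq_sqrt him, hnorm]
  conv_lhs => rw [← Real.sqrt_sq hω.le]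
  rw [← Real.sqrt_mul (sq_nonneg ω)]
  congr 1
  field_simp
end

section
/- Let ν be a positive measure on (0,∞) with ∫_{(0,∞)} (1+r)⁻¹ ν(dr) < ∞. Then the attenuation function A₁(ω) = ω² ∫_{(0,∞)} (ω² + r²)⁻¹ ν(dr) is real-analytic on (0,∞). -/
open MeasureTheory Filter Topology

lemma integrable_inv_add_sq {ν : Measure ℝ}
    (hν : IntegrableOn (fun r : ℝ => (1 + r)⁻¹) (Set.Ioi 0) ν) {c : ℝ} (hc : 0 < c) :
    IntegrableOn (fun r : ℝ => (c + r ^ 2)⁻¹) (Set.Ioi 0) ν := by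
  refine (hν.const_mul (2 / c + 1)).mono' (by fun_prop) ?_
  filter_upwards [ae_restrict_mem measurableSet_Ioi] with r (hr : 0 < r)
  rw [Real.norm_of_nonneg (by positivity), ← div_eq_mul_inv, inv_eq_one_div,
    div_le_div_iff₀ (by positivity) (by positivity)]
  have h : (2 / c + 1) * (c + r ^ 2) = 2 + c + 2 / c * r ^ 2 + r ^ 2 := by
    field_simp
    ring
  have : 0 ≤ 2 / c * r ^ 2 := by positivity
  nlinarith [sq_nonneg (r - 1)]

lemma add_sq_le_norm_add_sq {c : ℝ} {w : ℂ} (hw : c ≤ w.re) (r : ℝ) :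
    c + r ^ 2 ≤ ‖w + (r : ℂ) ^ 2‖ := by
  have h := Complex.re_le_norm (w + (r : ℂ) ^ 2)
  rw [Complex.add_re, ← Complex.ofReal_pow, Complex.ofReal_re] at h
  push_cast at h
  linarith

/-- The integral `∫ (w + r²)⁻¹ ν(dr)` is holomorphic in the right half-plane. -/
lemma differentiableAt_integral_inv_add_sq {ν : Measure ℝ}
    (hν : IntegrableOn (fun r : ℝ => (1 + r)⁻¹) (Set.Ioi 0) ν) {w₀ : ℂ} (hw₀ : 0 < w₀.re) :
    DifferentiableAt ℂ (fun w : ℂ => ∫ r in Set.Ioi (0 : ℝ), (w + (r : ℂ) ^ 2)⁻¹ ∂ν) w₀ := by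
  obtain ⟨c, hc, hcw⟩ := exists_between hw₀
  have hs : {w : ℂ | c < w.re} ∈ 𝓝 w₀ :=
    (isOpen_lt continuous_const Complex.continuous_re).mem_nhds hcw
  have hint := integrable_inv_add_sq hν hc
  refine (hasDerivAt_integral_of_dominated_loc_of_deriv_le
    (F := fun (w : ℂ) (r : ℝ) => (w + (r : ℂ) ^ 2)⁻¹)
    (F' := fun (w : ℂ) (r : ℝ) => -1 / (w + (r : ℂ) ^ 2) ^ 2)
    (bound := fun r => c⁻¹ * (c + r ^ 2)⁻¹) hs ?_ ?_ ?_ ?_ (hint.const_mul _)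
    ?_).2.differentiableAt
  · exact Eventually.of_forall fun w => by
      exact Measurable.aestronglyMeasurable (by fun_prop)
  · refine hint.mono' (Measurable.aestronglyMeasurable (by fun_prop)) ?_
    refine Eventually.of_forall fun r => ?_
    rw [norm_inv]
    exact inv_anti₀ (by positivity) (add_sq_le_norm_add_sq hcw.le r)
  · exact Measurable.aestronglyMeasurable (by fun_prop)
  · refine Eventually.of_forall fun r w (hw : c < w.re) => ?_
    have h := add_sq_le_norm_add_sq hw.le r
    have hr := sq_nonneg r
    rw [norm_div, norm_neg, norm_one, norm_pow, one_div, sq, mul_inv]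
    gcongr
    linarith
  · refine Eventually.of_forall fun r w (hw : c < w.re) => ?_
    have h := add_sq_le_norm_add_sq hw.le r
    have hne : w + (r : ℂ) ^ 2 ≠ 0 := norm_pos_iff.1 (by nlinarith [sq_nonneg r])
    exact ((hasDerivAt_id w).add_const ((r : ℂ) ^ 2)).inv hne

/-- If `ν` is a positive measure on `(0,∞)` with `∫ (1+r)⁻¹ ν(dr) < ∞`, then the
attenuation function `A₁(ω) = ω² ∫ (ω² + r²)⁻¹ ν(dr)` is real-analytic on `(0,∞)`. -/
theorem attenuation_real_analytic (ν : Measure ℝ)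
    (hν : IntegrableOn (fun r : ℝ => (1 + r)⁻¹) (Set.Ioi 0) ν)
    (A₁ : ℝ → ℝ)
    (hA : ∀ ω : ℝ, 0 < ω →
      A₁ ω = ω ^ 2 * ∫ r in Set.Ioi (0 : ℝ), (ω ^ 2 + r ^ 2)⁻¹ ∂ν) :
    ∀ ω : ℝ, 0 < ω → AnalyticAt ℝ A₁ ω := by
  intro ω hω
  set G : ℂ → ℂ := fun w => ∫ r in Set.Ioi (0 : ℝ), (w + (r : ℂ) ^ 2)⁻¹ ∂ν
  have hG : AnalyticAt ℂ G ((ω : ℂ) ^ 2) := by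
    have hd : DifferentiableOn ℂ G {w | 0 < w.re} := fun w hw =>
      (differentiableAt_integral_inv_add_sq hν hw).differentiableWithinAt
    refine hd.analyticAt ((isOpen_lt continuous_const Complex.continuous_re).mem_nhds ?_)
    rw [Set.mem_ofPred_eq, ← Complex.ofReal_pow, Complex.ofReal_re]
    positivity
  have hf : AnalyticAt ℂ (fun z : ℂ => z ^ 2 * G (z ^ 2)) (ω : ℂ) := by
    have hsq : AnalyticAt ℂ (fun z : ℂ => z ^ 2) (ω : ℂ) := by fun_prop
    exact hsq.mul (AnalyticAt.fun_comp (f := fun z : ℂ => z ^ 2) hG hsq)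
  refine hf.re_ofReal.congr ?_
  filter_upwards [lt_mem_nhds hω] with x hx
  have hGx : G ((x : ℂ) ^ 2) = ((∫ r in Set.Ioi (0 : ℝ), (x ^ 2 + r ^ 2)⁻¹ ∂ν : ℝ) : ℂ) := by
    rw [← integral_complex_ofReal]
    simp only [G]
    push_cast
    rfl
  rw [hA x hx, hGx, ← Complex.ofReal_pow, ← Complex.ofReal_mul, Complex.ofReal_re]
end
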